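/- arXiv:1410.8272 — 6 statements merged into one kernel-verified Lean document; each statement's English description precedes it below -/
import Mathlib

section
/- Let n ≥ 3 and let P = Conv(F ∪ {v}) ⊆ ℝⁿ be a lattice n-polytope which is a pyramid over a facet F with apex the vertex v ∉ F. Assume that P ∩ ℤⁿ = (F ∩ ℤⁿ) ∪ {v} and that the topological interior of the dilate (n−1)P contains exactly one point of ℤⁿ. If F is Gorenstein (as a lattice polytope of dimension n−1), then P is Gorenstein at every vertex. -/
open Set Pointwise

noncomputable section

/-- The set of lattice points of `ℝⁿ`: points with all coordinates integers. -/
def lat (n : ℕ) : Set (Fin n → ℝ) := {x | ∀ i, ∃ z : ℤ, x i = (z : ℝ)}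

/-- The dilate `kP` of a subset `P ⊆ ℝⁿ`. -/
def dilate (n k : ℕ) (P : Set (Fin n → ℝ)) : Set (Fin n → ℝ) :=
  (fun x => (k : ℝ) • x) '' P

/-- A lattice `n`-polytope: the convex hull of finitely many lattice points,
whose affine hull is all of `ℝⁿ`. -/
def IsLatticePolytope (n : ℕ) (P : Set (Fin n → ℝ)) : Prop :=
  (∃ S : Finset (Fin n → ℤ), S.Nonempty ∧
    P = convexHull ℝ ((fun m : Fin n → ℤ => fun i => (m i : ℝ)) '' (S : Set (Fin n → ℤ)))) ∧
  affineSpan ℝ P = ⊤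

/-- The cone of `P` at a point `v`: `C_v(P) = {r • (x - v) : r ≥ 0, x ∈ P}`. -/
def coneAt (n : ℕ) (P : Set (Fin n → ℝ)) (v : Fin n → ℝ) : Set (Fin n → ℝ) :=
  {y | ∃ r : ℝ, 0 ≤ r ∧ ∃ x ∈ P, y = r • (x - v)}

/-- `P` is Gorenstein at `v`: there is a lattice point `m₀` in `C_v(P)` with
`Int(C_v(P)) ∩ ℤⁿ = m₀ + (C_v(P) ∩ ℤⁿ)`. -/
def GorensteinAt (n : ℕ) (P : Set (Fin n → ℝ)) (v : Fin n → ℝ) : Prop :=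
  ∃ m₀ ∈ coneAt n P v ∩ lat n,
    interior (coneAt n P v) ∩ lat n = (fun y => m₀ + y) '' (coneAt n P v ∩ lat n)

/-- `P` is Gorenstein: it is Gorenstein at every vertex (extreme point). -/
def Gorenstein (n : ℕ) (P : Set (Fin n → ℝ)) : Prop :=
  ∀ v ∈ Set.extremePoints ℝ P, GorensteinAt n P v

/-- `F` is a facet of the `n`-polytope `P`: a face (extreme subset) of dimension `n-1`. -/
def IsFacet (n : ℕ) (P F : Set (Fin n → ℝ)) : Prop :=
  IsExtreme ℝ P F ∧ Module.finrank ℝ (affineSpan ℝ F).direction = n - 1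

/-- `P` is a pyramid: there are a facet `F` and a vertex `v ∉ F` with `P = Conv(F ∪ {v})`. -/
def IsPyramid (n : ℕ) (P : Set (Fin n → ℝ)) : Prop :=
  ∃ F v, IsFacet n P F ∧ v ∈ Set.extremePoints ℝ P ∧ v ∉ F ∧
    P = convexHull ℝ (F ∪ {v})

/-- The simplex `D_n = Conv{0, e₁, e₂, e₁+e₂+2e₃, e₄, …, eₙ}` (standard basis `e₁, …, eₙ`,
so `eᵢ = Pi.single i⁻¹` with 0-based indices; the points `Pi.single i 1` for `(i : ℕ) ≠ 2`
are `e₁, e₂, e₄, …, eₙ`, and the last listed point is `e₁ + e₂ + 2e₃`). -/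
def Dn (n : ℕ) : Set (Fin n → ℝ) :=
  convexHull ℝ ({0} ∪ {x | ∃ i : Fin n, (i : ℕ) ≠ 2 ∧ x = Pi.single i (1 : ℝ)} ∪
    {fun j : Fin n => if (j : ℕ) = 0 ∨ (j : ℕ) = 1 then (1 : ℝ) else
      if (j : ℕ) = 2 then 2 else 0})

/-- The affine map `x ↦ A·x + b` of `ℝⁿ` given by an integral matrix `A` and `b ∈ ℤⁿ`. -/
def unimodularMap (n : ℕ) (A : Matrix (Fin n) (Fin n) ℤ) (b : Fin n → ℤ) :
    (Fin n → ℝ) → (Fin n → ℝ) :=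
  fun x => (A.map (Int.cast : ℤ → ℝ)).mulVec x + fun i => (b i : ℝ)

/-- The basic simplex `Conv{0, e₁, …, eₙ}`. -/
def basicSimplex (n : ℕ) : Set (Fin n → ℝ) :=
  convexHull ℝ ({0} ∪ Set.range fun i : Fin n => (Pi.single i (1 : ℝ) : Fin n → ℝ))

/-- A ray (one-dimensional face) of a cone `C`. -/
def IsRay (n : ℕ) (C ρ : Set (Fin n → ℝ)) : Prop :=
  IsExtreme ℝ C ρ ∧ Module.finrank ℝ (Submodule.span ℝ ρ) = 1


/-- The convex cone generated by a finite set of vectors. -/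
def finiteCone {E : Type*} [AddCommGroup E] [Module ℝ E] (T : Finset E) : Set E :=
  {y | ∃ c : E → ℝ, (∀ x ∈ T, 0 ≤ c x) ∧ ∑ x ∈ T, c x • x = y}

lemma subset_finiteCone {E : Type*} [AddCommGroup E] [Module ℝ E] (T : Finset E) :
    (T : Set E) ⊆ finiteCone T := by
  classical
  intro x hx
  refine ⟨fun y => if y = x then 1 else 0, fun y _ => by dsimp only; split_ifs <;> norm_num, ?_⟩
  simp only [ite_smul, one_smul, zero_smul, Finset.sum_ite_eq', Finset.mem_coe.1 hx, if_true]

lemma add_mem_finiteCone {E : Type*} [AddCommGroup E] [Module ℝ E] {T : Finset E} {x y : E}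
    (hx : x ∈ finiteCone T) (hy : y ∈ finiteCone T) : x + y ∈ finiteCone T := by
  obtain ⟨c, hc, rfl⟩ := hx
  obtain ⟨d, hd, rfl⟩ := hy
  exact ⟨c + d, fun z hz => add_nonneg (hc z hz) (hd z hz), by
    simp [add_smul, Finset.sum_add_distrib]⟩

lemma smul_mem_finiteCone {E : Type*} [AddCommGroup E] [Module ℝ E] {T : Finset E} {r : ℝ}
    (hr : 0 ≤ r) {x : E} (hx : x ∈ finiteCone T) : r • x ∈ finiteCone T := by
  obtain ⟨c, hc, rfl⟩ := hx
  exact ⟨fun z => r * c z, fun z hz => mul_nonneg hr (hc z hz), by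
    simp [mul_smul, Finset.smul_sum]⟩

lemma exists_pos_of_mem_finiteCone {E : Type*} [AddCommGroup E] [Module ℝ E] {T : Finset E}
    {y : E} (hy : y ∈ finiteCone T) :
    ∃ U ⊆ T, ∃ c : E → ℝ, (∀ x ∈ U, 0 < c x) ∧ ∑ x ∈ U, c x • x = y := by
  classical
  obtain ⟨c, hc, rfl⟩ := hy
  refine ⟨T.filter fun x => 0 < c x, Finset.filter_subset _ _, c,
    fun x hx => (Finset.mem_filter.1 hx).2, Finset.sum_filter_of_ne fun x hx hne => ?_⟩
  exact (hc x hx).lt_of_ne fun h => hne (by rw [← h, zero_smul])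

/-- A nonnegative combination of linearly dependent vectors can be rewritten as one
that omits one of the vectors. -/
lemma exists_erase_mem_finiteCone {E : Type*} [AddCommGroup E] [Module ℝ E] [DecidableEq E]
    {T : Finset E} {y : E} (hy : y ∈ finiteCone T) (hT : ¬ LinearIndepOn ℝ id (T : Set E)) :
    ∃ a ∈ T, y ∈ finiteCone (T.erase a) := by
  obtain ⟨c, hc, rfl⟩ := hy
  rw [linearIndepOn_finset_iff] at hT
  push Not at hT
  obtain ⟨g₀, hg₀, i, hi, hgi⟩ := hT
  obtain ⟨g, hg, hpos⟩ : ∃ g : E → ℝ, ∑ x ∈ T, g x • x = 0 ∧ ∃ x ∈ T, 0 < g x := by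
    rcases lt_or_gt_of_ne hgi with h | h
    · exact ⟨-g₀, by simpa using hg₀, i, hi, by simpa using h⟩
    · exact ⟨g₀, by simpa using hg₀, i, hi, h⟩
  obtain ⟨j, hj, hgj⟩ := hpos
  obtain ⟨a, ha, hmin⟩ := Finset.exists_min_image (T.filter fun x => 0 < g x)
    (fun x => c x / g x) ⟨j, by simp [hj, hgj]⟩
  obtain ⟨haT, hga⟩ := Finset.mem_filter.1 ha
  refine ⟨a, haT, fun x => c x - c a / g a * g x, fun x hx => ?_, ?_⟩
  · have hxT := Finset.mem_of_mem_erase hx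
    have hr : 0 ≤ c a / g a := div_nonneg (hc a haT) hga.le
    rcases lt_or_ge 0 (g x) with h | h
    · have := hmin x (by simp [hxT, h])
      rw [le_div_iff₀ h] at this
      linarith
    · have := mul_nonpos_of_nonneg_of_nonpos hr h
      linarith [hc x hxT]
  · rw [Finset.sum_erase]
    · simp only [sub_smul, mul_smul, Finset.sum_sub_distrib, ← Finset.smul_sum, hg]
      simp
    · dsimp only
      rw [div_mul_cancel₀ _ hga.ne', sub_self, zero_smul]

/-- Carathéodory's theorem for cones. -/
lemma exists_linearIndepOn_of_mem_finiteCone {E : Type*} [AddCommGroup E] [Module ℝ E]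
    (T : Finset E) : ∀ y ∈ finiteCone T, ∃ U ⊆ T, LinearIndepOn ℝ id (U : Set E) ∧
      y ∈ finiteCone U := by
  classical
  induction T using Finset.strongInduction with
  | H T ih =>
    intro y hy
    by_cases hT : LinearIndepOn ℝ id (T : Set E)
    · exact ⟨T, subset_rfl, hT, hy⟩
    · obtain ⟨a, ha, hya⟩ := exists_erase_mem_finiteCone hy hT
      obtain ⟨U, hU, h⟩ := ih _ (Finset.erase_ssubset ha) y hya
      exact ⟨U, hU.trans (Finset.erase_subset _ _), h⟩

lemma finiteCone_mono {E : Type*} [AddCommGroup E] [Module ℝ E] {U T : Finset E} (h : U ⊆ T) :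
    finiteCone U ⊆ finiteCone T := by
  classical
  rintro y ⟨c, hc, rfl⟩
  refine ⟨fun x => if x ∈ U then c x else 0, fun x _ => ?_, ?_⟩
  · dsimp only
    split_ifs with hx
    exacts [hc x hx, le_rfl]
  · simp only [ite_smul, zero_smul]
    rw [Finset.sum_ite_mem, Finset.inter_eq_right.2 h]

lemma isClosed_finiteCone_of_linearIndepOn {E : Type*} [NormedAddCommGroup E] [NormedSpace ℝ E]
    [FiniteDimensional ℝ E] {U : Finset E} (hU : LinearIndepOn ℝ id (U : Set E)) :
    IsClosed (finiteCone U) := by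
  classical
  have hcl : IsClosed {c : U → ℝ | ∀ x, 0 ≤ c x} := by
    simp only [Set.ofPred_forall]
    exact isClosed_iInter fun x => isClosed_le continuous_const (continuous_apply x)
  have hker : LinearMap.ker (Fintype.linearCombination ℝ (fun x : U => (x : E))) = ⊥ :=
    LinearMap.ker_eq_bot.2 (LinearIndependent.fintypeLinearCombination_injective hU)
  convert (LinearMap.isClosedEmbedding_of_injective hker).isClosedMap _ hcl using 1
  ext y
  constructor
  · rintro ⟨c, hc, rfl⟩
    refine ⟨fun x => c x, fun x => hc x x.2, ?_⟩
    rw [Fintype.linearCombination_apply]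
    exact Finset.sum_coe_sort U (fun x => c x • x)
  · rintro ⟨c, hc, rfl⟩
    refine ⟨fun x => if h : x ∈ U then c ⟨x, h⟩ else 0, fun x hx => by simpa [hx] using hc ⟨x, hx⟩,
      ?_⟩
    rw [Fintype.linearCombination_apply, ← Finset.sum_coe_sort U]
    simp

lemma isClosed_finiteCone {E : Type*} [NormedAddCommGroup E] [NormedSpace ℝ E]
    [FiniteDimensional ℝ E] (T : Finset E) : IsClosed (finiteCone T) := by
  classical
  have h : finiteCone T =
      ⋃ U ∈ {U : Finset E | U ⊆ T ∧ LinearIndepOn ℝ id (U : Set E)}, finiteCone U := by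
    ext y
    simp only [Set.mem_iUnion, exists_prop, Set.mem_ofPred_eq]
    constructor
    · intro hy
      obtain ⟨U, hU, hi, hyU⟩ := exists_linearIndepOn_of_mem_finiteCone T y hy
      exact ⟨U, ⟨hU, hi⟩, hyU⟩
    · rintro ⟨U, ⟨hU, -⟩, hy⟩
      exact finiteCone_mono hU hy
  rw [h]
  refine Set.Finite.isClosed_biUnion ?_ fun U hU => isClosed_finiteCone_of_linearIndepOn hU.2
  exact (T.powerset.finite_toSet).subset fun U hU => by simpa using hU.1

/-- If `K` is closed under addition and nonnegative scaling and has nonempty interior, then for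
each `b ∈ K` outside the interior some functional is nonpositive on `K`, negative on the interior
and vanishes at `b`. -/
lemma exists_supporting_functional {E : Type*} [NormedAddCommGroup E] [NormedSpace ℝ E]
    {K : Set E} (hadd : ∀ x ∈ K, ∀ y ∈ K, x + y ∈ K)
    (hsmul : ∀ r : ℝ, 0 ≤ r → ∀ x ∈ K, r • x ∈ K) {q b : E} (hq : q ∈ interior K)
    (hb : b ∈ K) (hbint : b ∉ interior K) :
    ∃ f : StrongDual ℝ E, (∀ x ∈ K, f x ≤ 0) ∧ (∀ x ∈ interior K, f x < 0) ∧ f b = 0 := by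
  have hconv : Convex ℝ K := fun x hx y hy r s hr hs _ =>
    hadd _ (hsmul r hr x hx) _ (hsmul s hs y hy)
  obtain ⟨f, hf, hfK⟩ := geometric_hahn_banach_of_nonempty_interior_point hconv hbint ⟨q, hq⟩
  have hfb : f b = 0 := by
    have h0 := hfK _ (hsmul 0 le_rfl b hb)
    have h2 := hfK _ (hsmul 2 zero_le_two b hb)
    simp only [map_smul, smul_eq_mul] at h0 h2
    linarith
  refine ⟨f, fun x hx => hfb ▸ hfK x hx, fun x hx => ?_, hfb⟩
  obtain ⟨a, ha⟩ : ∃ a, f a ≠ 0 := by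
    by_contra! h
    exact hf (ContinuousLinearMap.ext h)
  have hopen := f.isOpenMap_of_ne_zero hf _ (isOpen_interior (s := K))
  have hsub : f '' interior K ⊆ Set.Iic 0 := by
    rintro _ ⟨y, hy, rfl⟩
    exact hfb ▸ hfK y (interior_subset hy)
  have := interior_maximal hsub hopen ⟨x, hx, rfl⟩
  rwa [interior_Iic] at this

/-- Among the points `q - t • m` with `0 ≤ t ≤ 1`, the last one in a closed set `K` lies on the
boundary if `x - m ∉ K`. -/
lemma exists_exit_point {E : Type*} [NormedAddCommGroup E] [NormedSpace ℝ E] {K : Set E}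
    (hK : IsClosed K) {q m : E} (hq : q ∈ interior K) (hqm : q - m ∉ K) :
    ∃ t : ℝ, 0 < t ∧ t < 1 ∧ q - t • m ∈ K ∧ q - t • m ∉ interior K := by
  have hcont : Continuous fun t : ℝ => q - t • m := by fun_prop
  have hcomp : IsCompact (Set.Icc (0 : ℝ) 1 ∩ (fun t : ℝ => q - t • m) ⁻¹' K) :=
    isCompact_Icc.inter_right (hK.preimage hcont)
  obtain ⟨t, ⟨⟨ht0, ht1⟩, htK⟩, hmax⟩ := hcomp.exists_isGreatest
    ⟨0, by simp, by simpa using interior_subset hq⟩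
  have htne : t ≠ 1 := by
    rintro rfl
    exact hqm (by simpa using htK)
  have htlt : t < 1 := lt_of_le_of_ne ht1 htne
  have hnot : q - t • m ∉ interior K := by
    intro hint
    have hnhds : ∀ᶠ s in nhds t, q - s • m ∈ interior K ∧ s < 1 :=
      (hcont.continuousAt.eventually (isOpen_interior.mem_nhds hint)).and (Iio_mem_nhds htlt)
    obtain ⟨s, ⟨hsK, hs1⟩, hts⟩ :=
      ((hnhds.filter_mono nhdsWithin_le_nhds).and
        (self_mem_nhdsWithin : Set.Ioi t ∈ nhdsWithin t (Set.Ioi t))).exists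
    have hsK' : q - s • m ∈ K := interior_subset hsK
    exact not_le.2 hts (hmax ⟨⟨ht0.trans (le_of_lt hts), hs1.le⟩, hsK'⟩)
  refine ⟨t, lt_of_le_of_ne ht0 ?_, htlt, htK, hnot⟩
  rintro rfl
  exact hnot (by simpa using hq)

lemma add_sum_smul_mem {E : Type*} [AddCommGroup E] [Module ℝ E] {P : Set E} (hP : Convex ℝ P)
    {w : E} (hw : w ∈ P) {U : Finset E} (hU : ∀ x ∈ U, w + x ∈ P) {c : E → ℝ}
    (hc : ∀ x ∈ U, 0 ≤ c x) (hsum : ∑ x ∈ U, c x ≤ 1) : w + ∑ x ∈ U, c x • x ∈ P := by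
  have hconv : Convex ℝ ((fun z => w + z) ⁻¹' P) := hP.translate_preimage_right w
  rcases (Finset.sum_nonneg hc).eq_or_lt with h0 | hpos
  · rw [Finset.sum_eq_zero fun x hx => by
      rw [(Finset.sum_eq_zero_iff_of_nonneg hc).1 h0.symm x hx, zero_smul]]
    simpa using hw
  · have hmem := hconv.smul_mem_of_zero_mem (by simpa using hw)
      (hconv.centerMass_mem hc hpos hU) ⟨hpos.le, hsum⟩
    rwa [Finset.centerMass, smul_inv_smul₀ hpos.ne'] at hmem

/-- Points `N w + t (p - N w) + ∑ c_x x` of level at most `N`, with `p` interior to `N P`,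
are interior to `N P`. -/
lemma combination_mem_interior {E : Type*} [NormedAddCommGroup E] [NormedSpace ℝ E] {P : Set E}
    (hP : Convex ℝ P) {N : ℝ} (hN : 0 < N) {p w : E} (hp : p ∈ interior (N • P)) (hw : w ∈ P)
    {U : Finset E} (hU : ∀ x ∈ U, w + x ∈ P) {c : E → ℝ} (hc : ∀ x ∈ U, 0 ≤ c x)
    {t : ℝ} (ht0 : 0 < t) (ht1 : t < 1) (hlevel : t * N + ∑ x ∈ U, c x ≤ N) :
    N • w + (t • (p - N • w) + ∑ x ∈ U, c x • x) ∈ interior (N • P) := by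
  have h1 : 0 < N * (1 - t) := mul_pos hN (by linarith)
  have hz : w + ∑ x ∈ U, (c x / (N * (1 - t))) • x ∈ P := by
    refine add_sum_smul_mem hP hw hU (fun x hx => div_nonneg (hc x hx) h1.le) ?_
    rw [← Finset.sum_div, div_le_one h1]
    linarith
  have := (hP.smul N).combo_interior_self_mem_interior hp (Set.smul_mem_smul_set (a := N) hz)
    ht0 (by linarith : 0 ≤ 1 - t) (by ring)
  convert this using 1
  have hs : ∑ x ∈ U, c x • x = (N * (1 - t)) • ∑ x ∈ U, (c x / (N * (1 - t))) • x := by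
    rw [Finset.smul_sum]
    refine Finset.sum_congr rfl fun x _ => ?_
    rw [smul_smul, mul_div_cancel₀ _ h1.ne']
  rw [hs]
  module

/-- If `p` is the unique lattice point in the interior of `N P`, where `N + 1` is the dimension,
then `q - (p - N w)` lies in the cone of `P` at `w` for each lattice point `q` interior to it. -/
lemma sub_mem_finiteCone_of_unique {E : Type*} [NormedAddCommGroup E] [NormedSpace ℝ E]
    [FiniteDimensional ℝ E] (L : AddSubgroup E) {P : Set E} (hP : Convex ℝ P) {N : ℕ}
    (hN : 0 < N) (hdim : Module.finrank ℝ E = N + 1) {p w : E}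
    (hp : interior ((N : ℝ) • P) ∩ L = {p}) (hw : w ∈ P) (hwL : w ∈ L) {T : Finset E}
    (hT : ∀ x ∈ T, w + x ∈ P) (hTL : ∀ x ∈ T, x ∈ L)
    (hm : p - (N : ℝ) • w ∈ interior (finiteCone T)) {q : E} (hq : q ∈ interior (finiteCone T))
    (hqL : q ∈ L) : q - (p - (N : ℝ) • w) ∈ finiteCone T := by
  have hNr : (0 : ℝ) < N := by exact_mod_cast hN
  have hp' : p ∈ interior ((N : ℝ) • P) ∩ L := hp ▸ Set.mem_singleton p
  have hNw : (N : ℝ) • w ∈ L := by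
    rw [Nat.cast_smul_eq_nsmul]
    exact L.nsmul_mem hwL N
  set m := p - (N : ℝ) • w with hm_def
  have hmL : m ∈ L := L.sub_mem hp'.2 hNw
  have huniq : ∀ z ∈ L, (N : ℝ) • w + z ∈ interior ((N : ℝ) • P) → z = m := by
    intro z hz hint
    have : (N : ℝ) • w + z ∈ ({p} : Set E) := hp ▸ ⟨hint, L.add_mem hNw hz⟩
    rw [hm_def, ← Set.mem_singleton_iff.1 this]
    abel
  by_contra hqm
  obtain ⟨t, ht0, ht1, hbK, hbint⟩ := exists_exit_point (isClosed_finiteCone T) hq hqm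
  obtain ⟨f, hfK, hfint, hfb⟩ := exists_supporting_functional
    (fun x hx y hy => add_mem_finiteCone hx hy) (fun r hr x hx => smul_mem_finiteCone hr hx)
    hq hbK hbint
  obtain ⟨U₀, hUT₀, hUi₀, hbU₀⟩ := exists_linearIndepOn_of_mem_finiteCone T _ hbK
  obtain ⟨U, hUU₀, c, hc, hcb⟩ := exists_pos_of_mem_finiteCone hbU₀
  have hUT : U ⊆ T := hUU₀.trans hUT₀
  have hUi : LinearIndepOn ℝ id (U : Set E) := hUi₀.mono (by exact_mod_cast hUU₀)
  have hfx : ∀ x ∈ U, f x = 0 := by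
    have hsum : ∑ x ∈ U, c x * f x = 0 := by
      rw [← hfb, ← hcb]
      simp
    intro x hx
    have := (Finset.sum_eq_zero_iff_of_nonpos fun y hy =>
      mul_nonpos_of_nonneg_of_nonpos (hc y hy).le
        (hfK y (subset_finiteCone T (hUT hy)))).1 hsum x hx
    exact (mul_eq_zero.1 this).resolve_left (hc x hx).ne'
  have hfm : f m < 0 := hfint m hm
  have hcard : (U.card : ℝ) ≤ N := by
    have hker : LinearMap.ker (f : E →ₗ[ℝ] ℝ) ≠ ⊤ := fun h => by
      have : m ∈ LinearMap.ker (f : E →ₗ[ℝ] ℝ) := h ▸ Submodule.mem_top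
      exact hfm.ne (by simpa using this)
    have hlt := Submodule.finrank_lt hker
    have hspan : Submodule.span ℝ (U : Set E) ≤ LinearMap.ker (f : E →ₗ[ℝ] ℝ) :=
      Submodule.span_le.2 fun x hx => by simpa using hfx x hx
    have hle := Submodule.finrank_mono hspan
    rw [finrank_span_finset_eq_card hUi] at hle
    exact_mod_cast (by omega : U.card ≤ N)
  have hUP : ∀ x ∈ U, w + x ∈ P := fun x hx => hT x (hUT hx)
  set r : E := t • m + ∑ x ∈ U, Int.fract (c x) • x with hr
  have hfloor : ∑ x ∈ U, (⌊c x⌋ : ℝ) • x ∈ L := L.sum_mem fun x hx => by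
    rw [Int.cast_smul_eq_zsmul]
    exact L.zsmul_mem (hTL x (hUT hx)) _
  have hrL : r ∈ L := by
    have : r = q - ∑ x ∈ U, (⌊c x⌋ : ℝ) • x := by
      have hq' : q = t • m + ∑ x ∈ U, c x • x := by
        rw [hcb]
        abel
      rw [hr, hq']
      simp only [Int.fract, sub_smul, Finset.sum_sub_distrib]
      abel
    rw [this]
    exact L.sub_mem hqL hfloor
  have hfr : f r = t * f m := by
    simp only [hr, map_add, map_smul, map_sum, smul_eq_mul]
    rw [Finset.sum_eq_zero fun x hx => by rw [hfx x hx, mul_zero], add_zero]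
  have hcompl : m + ∑ x ∈ U, x - r = (1 - t) • m + ∑ x ∈ U, (1 - Int.fract (c x)) • x := by
    simp only [hr, sub_smul, Finset.sum_sub_distrib, one_smul]
    abel
  have hcomplL : m + ∑ x ∈ U, x - r ∈ L :=
    L.sub_mem (L.add_mem hmL (L.sum_mem fun x hx => hTL x (hUT hx))) hrL
  rcases le_total (t * N + ∑ x ∈ U, Int.fract (c x)) N with hlevel | hlevel
  · have := combination_mem_interior hP hNr hp'.1 hw hUP
      (fun x _ => Int.fract_nonneg (c x)) ht0 ht1 hlevel
    rw [← hm_def, ← hr] at this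
    have hrm := huniq r hrL this
    rw [hrm] at hfr
    nlinarith
  · have hlevel' : (1 - t) * N + ∑ x ∈ U, (1 - Int.fract (c x)) ≤ N := by
      rw [Finset.sum_sub_distrib, Finset.sum_const, nsmul_eq_mul, mul_one]
      linarith
    have := combination_mem_interior hP hNr hp'.1 hw hUP
      (fun x _ => sub_nonneg.2 (Int.fract_lt_one (c x)).le) (sub_pos.2 ht1) (by linarith) hlevel'
    rw [← hm_def, ← hcompl] at this
    have hrm := huniq _ hcomplL this
    have hfsum : f r = 0 := by
      have : r = ∑ x ∈ U, x := by
        rw [add_sub_assoc] at hrm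
        exact (sub_eq_zero.1 (add_eq_left.1 hrm)).symm
      rw [this, map_sum, Finset.sum_eq_zero hfx]
    rw [hfr] at hfsum
    nlinarith

/-- The lattice `ℤⁿ` as an additive subgroup of `ℝⁿ`. -/
def latSubgroup (n : ℕ) : AddSubgroup (Fin n → ℝ) where
  carrier := lat n
  zero_mem' := fun _ => ⟨0, by simp⟩
  add_mem' := fun {x y} hx hy i => by
    obtain ⟨a, ha⟩ := hx i
    obtain ⟨b, hb⟩ := hy i
    exact ⟨a + b, by simp [ha, hb]⟩
  neg_mem' := fun {x} hx i => by
    obtain ⟨a, ha⟩ := hx i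
    exact ⟨-a, by simp [ha]⟩

/-- The cone of the convex hull of a finite set at one of its points. -/
lemma coneAt_convexHull_eq_finiteCone {n : ℕ} [DecidableEq (Fin n → ℝ)]
    (V : Finset (Fin n → ℝ)) {w : Fin n → ℝ} (hw : w ∈ convexHull ℝ (V : Set (Fin n → ℝ))) :
    coneAt n (convexHull ℝ (V : Set (Fin n → ℝ))) w = finiteCone (V.image fun x => x - w) := by
  have hinj : Set.InjOn (fun x => x - w) (V : Set (Fin n → ℝ)) := sub_left_injective.injOn
  ext y
  constructor
  · rintro ⟨r, hr, x, hx, rfl⟩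
    obtain ⟨a, ha, ha1, rfl⟩ := Finset.mem_convexHull'.1 hx
    refine ⟨fun z => r * a (z + w), fun z hz => ?_, ?_⟩
    · obtain ⟨u, hu, rfl⟩ := Finset.mem_image.1 hz
      simpa using mul_nonneg hr (ha u hu)
    · rw [Finset.sum_image hinj]
      simp only [sub_add_cancel, mul_smul, ← Finset.smul_sum, smul_sub, Finset.sum_sub_distrib,
        ← Finset.sum_smul, ha1, one_smul]
  · rintro ⟨c, hc, rfl⟩
    set s := ∑ x ∈ V.image (fun x => x - w), c x
    have hs : 0 ≤ s := Finset.sum_nonneg hc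
    have hs1 : 0 < s + 1 := by linarith
    refine ⟨s + 1, hs1.le, w + ∑ x ∈ V.image (fun x => x - w), (c x / (s + 1)) • x,
      add_sum_smul_mem (convex_convexHull ℝ _) hw ?_ (fun x hx => div_nonneg (hc x hx) hs1.le) ?_,
      ?_⟩
    · intro x hx
      obtain ⟨u, hu, rfl⟩ := Finset.mem_image.1 hx
      simpa using subset_convexHull ℝ (V : Set (Fin n → ℝ)) hu
    · rw [← Finset.sum_div, div_le_one hs1]
      linarith
    · rw [add_sub_cancel_left, Finset.smul_sum]
      refine Finset.sum_congr rfl fun x _ => ?_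
      rw [smul_smul, mul_div_cancel₀ _ hs1.ne']

/-- A lattice `n`-polytope `P` with exactly one lattice point in the interior of `(n-1)P` is
Gorenstein. -/
theorem gorenstein_of_unique_interior_point {n : ℕ} (hn : 2 ≤ n) {P : Set (Fin n → ℝ)}
    (hP : IsLatticePolytope n P) {p : Fin n → ℝ}
    (hp : interior (dilate n (n - 1) P) ∩ lat n = {p}) : Gorenstein n P := by
  classical
  intro w hwext
  obtain ⟨⟨S, -, hS⟩, -⟩ := hP
  set V : Finset (Fin n → ℝ) := S.image fun m i => (m i : ℝ) with hV
  have hPV : P = convexHull ℝ (V : Set (Fin n → ℝ)) := by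
    rw [hS, hV, Finset.coe_image]
  have hVL : ∀ x ∈ V, x ∈ lat n := by
    intro x hx
    obtain ⟨m, -, rfl⟩ := Finset.mem_image.1 hx
    exact fun i => ⟨m i, rfl⟩
  have hconv : Convex ℝ P := hPV ▸ convex_convexHull ℝ _
  have hwP : w ∈ P := hwext.1
  have hwV : w ∈ V := by
    rw [hPV] at hwext
    exact extremePoints_convexHull_subset hwext
  set T := V.image fun x => x - w with hT
  have hK : coneAt n P w = finiteCone T := by
    rw [hPV]
    exact coneAt_convexHull_eq_finiteCone V (hPV ▸ hwP)
  set N := n - 1 with hN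
  have hdil : dilate n N P = (N : ℝ) • P := rfl
  rw [hdil] at hp
  have hp' : p ∈ interior ((N : ℝ) • P) ∩ lat n := hp ▸ Set.mem_singleton p
  have hm : p - (N : ℝ) • w ∈ interior (finiteCone T) := by
    have hopen : IsOpen ((fun z => z - (N : ℝ) • w) '' interior ((N : ℝ) • P)) :=
      (Homeomorph.subRight ((N : ℝ) • w)).isOpenMap _ isOpen_interior
    refine interior_maximal ?_ hopen ⟨p, hp'.1, rfl⟩
    rintro _ ⟨z, hz, rfl⟩
    obtain ⟨x, hx, rfl⟩ := interior_subset hz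
    rw [← hK]
    exact ⟨N, N.cast_nonneg, x, hx, (smul_sub _ _ _).symm⟩
  have hmL : p - (N : ℝ) • w ∈ latSubgroup n := by
    rw [Nat.cast_smul_eq_nsmul]
    exact (latSubgroup n).sub_mem hp'.2 ((latSubgroup n).nsmul_mem (hVL w hwV) N)
  rw [GorensteinAt, hK]
  refine ⟨p - (N : ℝ) • w, ⟨interior_subset hm, hmL⟩, Set.Subset.antisymm ?_ ?_⟩
  · rintro q ⟨hq, hqL⟩
    refine ⟨q - (p - (N : ℝ) • w), ⟨?_, (latSubgroup n).sub_mem hqL hmL⟩, add_sub_cancel _ q⟩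
    refine sub_mem_finiteCone_of_unique (latSubgroup n) hconv (by omega)
      (by rw [Module.finrank_fin_fun]; omega) hp hwP (hVL w hwV) ?_ ?_ hm hq hqL
    · intro x hx
      obtain ⟨u, hu, rfl⟩ := Finset.mem_image.1 hx
      rw [add_sub_cancel, hPV]
      exact subset_convexHull ℝ _ hu
    · intro x hx
      obtain ⟨u, hu, rfl⟩ := Finset.mem_image.1 hx
      exact (latSubgroup n).sub_mem (hVL u hu) (hVL w hwV)
  · rintro _ ⟨y, ⟨hy, hyL⟩, rfl⟩
    refine ⟨?_, (latSubgroup n).add_mem hmL hyL⟩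
    have hopen : IsOpen ((fun z => z + y) '' interior (finiteCone T)) :=
      (Homeomorph.addRight y).isOpenMap _ isOpen_interior
    refine interior_maximal ?_ hopen ⟨_, hm, rfl⟩
    rintro _ ⟨z, hz, rfl⟩
    exact add_mem_finiteCone (interior_subset hz) hy

/-- For `n ≥ 3`: a lattice `n`-pyramid `P = Conv(F ∪ {v})` over a facet `F` with apex `v`,
with `P ∩ ℤⁿ = (F ∩ ℤⁿ) ∪ {v}` and exactly one lattice point in the interior of `(n-1)P`,
is Gorenstein provided `F` is Gorenstein (as an `(n-1)`-dimensional lattice polytope,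
using relative interiors of the vertex cones of `F`). -/
theorem pyramid_gorenstein_of_facet_gorenstein (n : ℕ) (hn : 3 ≤ n)
    (P F : Set (Fin n → ℝ)) (v : Fin n → ℝ)
    (hP : IsLatticePolytope n P)
    (hF : IsFacet n P F) (hv : v ∈ Set.extremePoints ℝ P) (hvF : v ∉ F)
    (hconv : P = convexHull ℝ (F ∪ {v}))
    (hlat : P ∩ lat n = (F ∩ lat n) ∪ {v})
    (hint : ∃ m₀, interior (dilate n (n - 1) P) ∩ lat n = {m₀})
    (hFgor : ∀ w ∈ Set.extremePoints ℝ F, ∃ m₀ ∈ coneAt n F w ∩ lat n,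
      intrinsicInterior ℝ (coneAt n F w) ∩ lat n =
        (fun y => m₀ + y) '' (coneAt n F w ∩ lat n)) :
    Gorenstein n P := by
  obtain ⟨p, hp⟩ := hint
  exact gorenstein_of_unique_interior_point (by omega) hP hp
end
end

section
/- Let P = Conv(F ∪ {v}) ⊆ ℝ³ be a lattice 3-polytope which is a pyramid over a facet F with apex the vertex v ∉ F, and assume P ∩ ℤ³ = (F ∩ ℤ³) ∪ {v}. If the topological interior of the dilate 2P contains exactly one point of ℤ³, then P is Gorenstein at every vertex. -/
open Set Pointwise

noncomputable section

/-- The lattice points of `ℝⁿ` as an additive subgroup. -/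
def latAddSubgroup (n : ℕ) : AddSubgroup (Fin n → ℝ) where
  carrier := lat n
  zero_mem' := fun _ => ⟨0, by simp⟩
  add_mem' := fun {x y} hx hy i => by
    obtain ⟨a, ha⟩ := hx i
    obtain ⟨b, hb⟩ := hy i
    exact ⟨a + b, by simp [ha, hb]⟩
  neg_mem' := fun {x} hx i => by
    obtain ⟨a, ha⟩ := hx i
    exact ⟨-a, by simp [ha]⟩

theorem intCast_smul_mem_latAddSubgroup {n : ℕ} {x : Fin n → ℝ} (hx : x ∈ latAddSubgroup n)
    (z : ℤ) : (z : ℝ) • x ∈ latAddSubgroup n := by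
  rw [Int.cast_smul_eq_zsmul]
  exact zsmul_mem hx z

section Convex

variable {E : Type*} [AddCommGroup E] [Module ℝ E] [TopologicalSpace E]

/-- `x` lies in the interior of the dilate `tP`, where `t > 0`. -/
def InteriorDilate (P : Set E) (t : ℝ) (x : E) : Prop :=
  0 < t ∧ ∃ q ∈ interior P, x = t • q

theorem InteriorDilate.smul {P : Set E} {t c : ℝ} {x : E} (h : InteriorDilate P t x)
    (hc : 0 < c) : InteriorDilate P (c * t) (c • x) := by
  obtain ⟨ht, q, hq, rfl⟩ := h
  exact ⟨by positivity, q, hq, smul_smul _ _ _⟩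

variable [IsTopologicalAddGroup E] [ContinuousSMul ℝ E]

theorem InteriorDilate.add_smul {P : Set E} (hP : Convex ℝ P) {t s : ℝ} {x p : E}
    (h : InteriorDilate P t x) (hs : 0 ≤ s) (hp : p ∈ P) :
    InteriorDilate P (t + s) (x + s • p) := by
  obtain ⟨ht, q, hq, rfl⟩ := h
  have hts : 0 < t + s := by positivity
  refine ⟨hts, (t / (t + s)) • q + (s / (t + s)) • p,
    hP.combo_interior_self_mem_interior hq hp (by positivity) (by positivity) (by field_simp), ?_⟩
  rw [smul_add, smul_smul, smul_smul, mul_div_cancel₀ _ hts.ne', mul_div_cancel₀ _ hts.ne']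

theorem InteriorDilate.add_sum {P : Set E} (hP : Convex ℝ P) {ι : Type*} (T : Finset ι)
    {t : ℝ} {x : E} {s : ι → ℝ} {p : ι → E}
    (h : InteriorDilate P t x) (hs : ∀ i, 0 ≤ s i) (hp : ∀ i, p i ∈ P) :
    InteriorDilate P (t + ∑ i ∈ T, s i) (x + ∑ i ∈ T, s i • p i) := by
  classical
  induction T using Finset.induction_on with
  | empty => simpa using h
  | insert a T ha ih =>
    rw [Finset.sum_insert ha, Finset.sum_insert ha, add_comm (s a), add_comm (s a • p a),
      ← add_assoc, ← add_assoc]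
    exact ih.add_smul hP (hs a) (hp a)

end Convex

universe u in
/-- A point of a convex hull that is not interior is a positive convex combination of at most
`dim` points of the generating set. -/
theorem exists_pos_convex_combination_card_le_finrank {E : Type u} [NormedAddCommGroup E]
    [NormedSpace ℝ E] [FiniteDimensional ℝ E] {S : Set E} {x : E}
    (hx : x ∈ convexHull ℝ S) (hxi : x ∉ interior (convexHull ℝ S)) :
    ∃ (ι : Type u) (_ : Fintype ι) (z : ι → E) (w : ι → ℝ), (∀ i, z i ∈ S) ∧
      Fintype.card ι ≤ Module.finrank ℝ E ∧ (∀ i, 0 < w i) ∧ ∑ i, w i = 1 ∧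
      ∑ i, w i • z i = x := by
  obtain ⟨ι, _, z, w, hz, hind, hw, hw1, hwx⟩ := eq_pos_convex_span_of_mem_convexHull hx
  refine ⟨ι, inferInstance, z, w, fun i => hz ⟨i, rfl⟩, ?_, hw, hw1, hwx⟩
  by_contra! hcard
  have hle := (hind.card_le_finrank_succ).trans
    (Nat.succ_le_succ (Submodule.finrank_le (vectorSpan ℝ (Set.range z))))
  have htop : affineSpan ℝ (Set.range z) = ⊤ := by
    rw [hind.affineSpan_eq_top_iff_card_eq_finrank_add_one]
    omega
  let b : AffineBasis ι ℝ E := ⟨z, hind, htop⟩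
  have hxb : x ∈ interior (convexHull ℝ (Set.range b)) := by
    rw [b.interior_convexHull]
    intro i
    have hcomb : Finset.univ.affineCombination ℝ b w = x := by
      rw [Finset.affineCombination_eq_linear_combination _ _ _ hw1]
      exact hwx
    rw [← hcomb, b.coord_apply_combination_of_mem (Finset.mem_univ i) hw1]
    exact hw i
  exact hxi (interior_mono (convexHull_mono hz) hxb)

/-- Let `P` be a lattice `3`-polytope without interior lattice points such that `m` is the only
interior lattice point of `2P`. Then subtracting `m` maps the interior lattice points of `kP`
into `(k-2)P`. -/
theorem sub_mem_dilate_of_mem_interior_dilate {S : Set (Fin 3 → ℝ)} (hSfin : S.Finite)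
    (hS : S ⊆ lat 3) {m : Fin 3 → ℝ} (hm : m ∈ lat 3)
    (hm2 : InteriorDilate (convexHull ℝ S) 2 m)
    (h1 : ∀ x ∈ lat 3, x ∉ interior (convexHull ℝ S))
    (h2 : ∀ x ∈ lat 3, InteriorDilate (convexHull ℝ S) 2 x → x = m)
    {k : ℕ} (hk : 3 ≤ k) {y : Fin 3 → ℝ} (hy : y ∈ lat 3)
    (hyk : InteriorDilate (convexHull ℝ S) k y) :
    ∃ p ∈ convexHull ℝ S, y - m = ((k : ℝ) - 2) • p := by
  set P := convexHull ℝ S with hPdef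
  have hP : Convex ℝ P := convex_convexHull ℝ S
  have hk' : (3 : ℝ) ≤ k := by exact_mod_cast hk
  have hden : ∀ α ∈ Icc (0 : ℝ) 1, (k : ℝ) - 2 * α ≠ 0 := fun α hα => by
    have := hα.2
    linarith
  set φ : ℝ → Fin 3 → ℝ := fun α => ((k : ℝ) - 2 * α)⁻¹ • (y - α • m) with hφ
  have hφ_eq : ∀ α ∈ Icc (0 : ℝ) 1, y = α • m + ((k : ℝ) - 2 * α) • φ α := fun α hα => by
    rw [hφ]
    simp only
    rw [smul_inv_smul₀ (hden α hα)]
    abel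
  by_cases hφ1 : φ 1 ∈ P
  · refine ⟨φ 1, hφ1, ?_⟩
    have := hφ_eq 1 (by simp)
    rw [one_smul, mul_one] at this
    rw [sub_eq_iff_eq_add']
    exact this
  exfalso
  have hφcont : ContinuousOn φ (Icc 0 1) := by
    refine ContinuousOn.smul (ContinuousOn.inv₀ (by fun_prop) hden) (by fun_prop)
  have hφ0 : φ 0 ∈ interior P := by
    obtain ⟨hk0, q, hq, hyq⟩ := hyk
    have : φ 0 = q := by simp [hφ, hyq, smul_smul, hk0.ne']
    rwa [this]
  obtain ⟨α, hα, hαP, hαint⟩ : ∃ α ∈ Icc (0 : ℝ) 1, φ α ∈ P ∧ φ α ∉ interior P := by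
    by_contra! hall
    obtain ⟨x, -, hxint, hxP⟩ := isPreconnected_Icc.image φ hφcont (interior P) Pᶜ isOpen_interior
      (hSfin.isCompact_convexHull ℝ).isClosed.isOpen_compl
      (by
        rintro _ ⟨α, hα, rfl⟩
        by_cases h : φ α ∈ P
        · exact Or.inl (hall α hα h)
        · exact Or.inr h)
      ⟨φ 0, ⟨0, by simp, rfl⟩, hφ0⟩ ⟨φ 1, ⟨1, by simp, rfl⟩, hφ1⟩
    exact hxP (interior_subset hxint)
  have hα0 : 0 < α := lt_of_le_of_ne hα.1 fun h => hαint (h ▸ hφ0)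
  have hα1 : α < 1 := lt_of_le_of_ne hα.2 fun h => hφ1 (h ▸ hαP)
  obtain ⟨ι, _, z, w, hz, hcard, hw, hw1, hwx⟩ :=
    exists_pos_convex_combination_card_le_finrank hαP hαint
  rw [Module.finrank_fin_fun] at hcard
  have hzP : ∀ i, z i ∈ P := fun i => subset_convexHull ℝ S (hz i)
  have hkα : 0 < (k : ℝ) - 2 * α := by linarith
  set β : ι → ℝ := fun i => ((k : ℝ) - 2 * α) * w i with hβ
  have hβ0 : ∀ i, 0 < β i := fun i => mul_pos hkα (hw i)
  have hβsum : ∑ i, β i = (k : ℝ) - 2 * α := by rw [hβ, ← Finset.mul_sum, hw1, mul_one]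
  have hβz : ∑ i, β i • z i = ((k : ℝ) - 2 * α) • φ α := by
    rw [← hwx, Finset.smul_sum]
    simp [hβ, smul_smul]
  have hyβ : y = α • m + ∑ i, β i • z i := by rw [hβz]; exact hφ_eq α hα
  have hnot : ∀ (c : ℝ), 0 < c → ∀ t, ∀ γ : ι → ℝ, (∀ i, 0 ≤ γ i) → t + ∑ i, γ i = c →
      ∀ x, InteriorDilate P t x → c • φ α ≠ x + ∑ i, γ i • z i := by
    intro c hc t γ hγ htc x hx hcx
    have h := hx.add_sum hP Finset.univ hγ hzP
    rw [htc, ← hcx] at h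
    obtain ⟨_, q, hq, heq⟩ := h
    exact hαint (smul_right_injective _ hc.ne' heq ▸ hq)
  have hlevel : ∀ (N : ℤ) (x : Fin 3 → ℝ), x ∈ lat 3 → InteriorDilate P N x → 2 ≤ N := by
    intro N x hx h
    have hN : 0 < N := by exact_mod_cast h.1
    by_contra! hlt
    obtain rfl : N = 1 := by omega
    obtain ⟨_, q, hq, rfl⟩ := h
    exact h1 _ hx (by simpa using hq)
  have hzlat : ∀ g : ι → ℤ, ∑ i, (g i : ℝ) • z i ∈ latAddSubgroup 3 := fun g =>
    sum_mem fun i _ => intCast_smul_mem_latAddSubgroup (hS (hz i)) _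
  -- The two lattice points obtained by rounding the coefficients down and up.
  set B := α • m + ∑ i, Int.fract (β i) • z i with hB
  set A := (1 - α) • m + ∑ i, (⌈β i⌉ - β i) • z i with hA
  have hBlat : B ∈ lat 3 := by
    have : B = y - ∑ i, (⌊β i⌋ : ℝ) • z i := by
      rw [hyβ, add_sub_assoc, ← Finset.sum_sub_distrib, hB]
      simp only [← sub_smul, Int.fract]
    rw [this]
    exact (latAddSubgroup 3).sub_mem hy (hzlat _)
  have hAlat : A ∈ lat 3 := by
    have : A = m + ∑ i, (⌈β i⌉ : ℝ) • z i - y := by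
      rw [hyβ, hA]
      simp only [sub_smul, Finset.sum_sub_distrib, one_smul]
      abel
    rw [this]
    exact (latAddSubgroup 3).sub_mem ((latAddSubgroup 3).add_mem hm (hzlat _)) hy
  have hBint : InteriorDilate P ((k - ∑ i, ⌊β i⌋ : ℤ) : ℝ) B := by
    have := (hm2.smul hα0).add_sum hP Finset.univ (fun i => Int.fract_nonneg (β i)) hzP
    convert this using 1
    push_cast
    simp only [Int.fract, Finset.sum_sub_distrib, hβsum]
    ring
  have hceil : ∀ i, 0 ≤ (⌈β i⌉ : ℝ) - β i := fun i => sub_nonneg.2 (Int.le_ceil _)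
  have hAint : InteriorDilate P ((2 + ∑ i, ⌈β i⌉ - k : ℤ) : ℝ) A := by
    have := (hm2.smul (sub_pos.2 hα1)).add_sum hP Finset.univ hceil hzP
    convert this using 1
    push_cast
    simp only [Finset.sum_sub_distrib, hβsum]
    ring
  have hB2 := hlevel _ _ hBlat hBint
  have hA2 := hlevel _ _ hAlat hAint
  have hdiff : ∑ i, ⌈β i⌉ ≤ ∑ i, ⌊β i⌋ + 3 := by
    calc ∑ i, ⌈β i⌉ ≤ ∑ i, (⌊β i⌋ + 1) := Finset.sum_le_sum fun i _ => Int.ceil_le_floor_add_one _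
      _ = ∑ i, ⌊β i⌋ + Fintype.card ι := by simp [Finset.sum_add_distrib]
      _ ≤ _ := by gcongr; exact_mod_cast hcard
  rcases (by omega : (k : ℤ) - ∑ i, ⌊β i⌋ = 2 ∨ (2 : ℤ) + ∑ i, ⌈β i⌉ - k = 2) with h | h
  · rw [h] at hBint
    have hBm := h2 B hBlat (by simpa using hBint)
    refine hnot _ hkα ((1 - α) * 2) (fun i => ⌊β i⌋)
      (fun i => by exact_mod_cast Int.floor_nonneg.2 (hβ0 i).le) ?_ ((1 - α) • m)
      (hm2.smul (sub_pos.2 hα1)) ?_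
    · have : (k : ℝ) - ∑ i, (⌊β i⌋ : ℝ) = 2 := by exact_mod_cast h
      linarith
    · have : ∑ i, Int.fract (β i) • z i = (1 - α) • m := by
        rw [sub_smul, one_smul, eq_sub_iff_add_eq', ← hB, hBm]
      rw [← hβz, ← this, ← Finset.sum_add_distrib]
      simp only [← add_smul, Int.fract_add_floor]
  · rw [h] at hAint
    have hAm := h2 A hAlat (by simpa using hAint)
    obtain ⟨N, hN⟩ : ∃ N : ℝ, ∀ i, ⌈β i⌉ - β i ≤ N * β i := by
      obtain ⟨N, hN⟩ := (Set.finite_range fun i => (⌈β i⌉ - β i) / β i).bddAbove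
      exact ⟨N, fun i => (div_le_iff₀ (hβ0 i)).1 (hN ⟨i, rfl⟩)⟩
    have hN' : ∀ i, ⌈β i⌉ - β i ≤ max N 1 * β i := fun i =>
      (hN i).trans (mul_le_mul_of_nonneg_right (le_max_left _ _) (hβ0 i).le)
    have hNpos : 0 < max N 1 := lt_max_of_lt_right one_pos
    refine hnot (max N 1 * (k - 2 * α)) (mul_pos hNpos hkα) (α * 2)
      (fun i => max N 1 * β i - (⌈β i⌉ - β i)) (fun i => sub_nonneg.2 (hN' i)) ?_ (α • m)
      (hm2.smul hα0) ?_
    · have : (2 : ℝ) + ∑ i, (⌈β i⌉ : ℝ) - k = 2 := by exact_mod_cast h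
      simp only [Finset.sum_sub_distrib, ← Finset.mul_sum, hβsum]
      linarith
    · have : ∑ i, (⌈β i⌉ - β i) • z i = α • m := by
        have h' : (1 - α) • m + ∑ i, (⌈β i⌉ - β i) • z i = m := hA ▸ hAm
        rw [sub_smul, one_smul] at h'
        linear_combination h'
      rw [← this, mul_smul, ← hβz, Finset.smul_sum, ← Finset.sum_add_distrib]
      refine Finset.sum_congr rfl fun i _ => ?_
      rw [smul_smul, ← add_smul]
      congr 1
      ring

theorem InteriorDilate.mem_interior_coneAt {n : ℕ} {P : Set (Fin n → ℝ)} {w : Fin n → ℝ} {r : ℝ}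
    {x : Fin n → ℝ} (h : InteriorDilate P r x) : x - r • w ∈ interior (coneAt n P w) := by
  obtain ⟨hr, q, hq, rfl⟩ := h
  refine mem_interior.2 ⟨(fun z => r⁻¹ • z + w) ⁻¹' interior P, fun z hz => ?_,
    isOpen_interior.preimage (by fun_prop), ?_⟩
  · refine ⟨r, hr.le, r⁻¹ • z + w, interior_subset hz, ?_⟩
    rw [add_sub_cancel_right, smul_inv_smul₀ hr.ne']
  · simpa [← smul_sub, smul_smul, hr.ne'] using hq

theorem exists_interiorDilate_of_mem_interior_coneAt {n : ℕ} {P : Set (Fin n → ℝ)}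
    (hP : Convex ℝ P) {q w z : Fin n → ℝ} (hq : q ∈ interior P)
    (hz : z ∈ interior (coneAt n P w)) :
    ∃ r : ℝ, InteriorDilate P r (z + r • w) := by
  have hcont : Filter.Tendsto (fun ε : ℝ => z - ε • (q - w)) (nhdsWithin 0 (Ioi 0)) (nhds z) := by
    have : Continuous fun ε : ℝ => z - ε • (q - w) := by fun_prop
    simpa using (this.tendsto 0).mono_left nhdsWithin_le_nhds
  obtain ⟨ε, ⟨r, hr, x, hx, hzx⟩, hε⟩ :=
    ((hcont.eventually (mem_interior_iff_mem_nhds.1 hz)).and self_mem_nhdsWithin).exists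
  refine ⟨ε + r, ?_⟩
  have hεq : InteriorDilate P ε (ε • q) := ⟨hε, q, hq, rfl⟩
  convert hεq.add_smul hP hr hx using 1
  rw [sub_eq_iff_eq_add] at hzx
  rw [hzx]
  module

/-- A criterion for being Gorenstein at a lattice point `w` of `P`, in terms of an interior
lattice point of `2P`. -/
theorem gorensteinAt_of_sub_mem {n : ℕ} {P : Set (Fin n → ℝ)} (hP : Convex ℝ P)
    {m w : Fin n → ℝ} (hm : m ∈ lat n) (hm2 : InteriorDilate P 2 m)
    (hsub : ∀ k : ℕ, 3 ≤ k → ∀ y ∈ lat n, InteriorDilate P k y →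
      ∃ p ∈ P, y - m = ((k : ℝ) - 2) • p)
    (hw : w ∈ P) (hwlat : w ∈ lat n) : GorensteinAt n P w := by
  have hm0 : m - (2 : ℝ) • w ∈ latAddSubgroup n :=
    sub_mem hm (by simpa using intCast_smul_mem_latAddSubgroup (x := w) hwlat 2)
  refine ⟨m - (2 : ℝ) • w, ⟨interior_subset hm2.mem_interior_coneAt, hm0⟩, Subset.antisymm ?_ ?_⟩
  · rintro z ⟨hz, hzlat⟩
    obtain ⟨-, q, hq, -⟩ := hm2
    obtain ⟨r, hr⟩ := exists_interiorDilate_of_mem_interior_coneAt hP hq hz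
    obtain ⟨k, hk⟩ := exists_nat_ge (max r 3)
    have hk3 : (3 : ℝ) ≤ k := (le_max_right _ _).trans hk
    have hkw : InteriorDilate P k (z + (k : ℝ) • w) := by
      convert hr.add_smul hP (sub_nonneg.2 ((le_max_left _ _).trans hk)) hw using 1
      · ring
      · module
    have hzk : z + (k : ℝ) • w ∈ latAddSubgroup n :=
      add_mem hzlat (by simpa using intCast_smul_mem_latAddSubgroup (x := w) hwlat k)
    obtain ⟨p, hp, hpk⟩ := hsub k (by exact_mod_cast hk3) _ hzk hkw
    refine ⟨z - (m - (2 : ℝ) • w), ⟨⟨k - 2, by linarith, p, hp, ?_⟩, sub_mem hzlat hm0⟩, ?_⟩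
    · rw [smul_sub, ← hpk]
      module
    · simp
  · rintro _ ⟨_, ⟨⟨r, hr, x, hx, rfl⟩, hlat⟩, rfl⟩
    refine ⟨?_, (latAddSubgroup n).add_mem hm0 hlat⟩
    convert (hm2.add_smul hP hr hx).mem_interior_coneAt (w := w) using 1
    module

/-- A proper extreme subset of a set does not meet its interior. -/
theorem IsExtreme.notMem_interior {E : Type*} [AddCommGroup E] [Module ℝ E] [TopologicalSpace E]
    [IsTopologicalAddGroup E] [ContinuousSMul ℝ E] {P F : Set E} (hF : IsExtreme ℝ P F)
    {v x : E} (hv : v ∈ P) (hvF : v ∉ F) (hx : x ∈ F) : x ∉ interior P := by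
  intro hxi
  have hcont : Filter.Tendsto (fun ε : ℝ => x + ε • (x - v)) (nhdsWithin 0 (Ioi 0)) (nhds x) := by
    have : Continuous fun ε : ℝ => x + ε • (x - v) := by fun_prop
    simpa using (this.tendsto 0).mono_left nhdsWithin_le_nhds
  obtain ⟨ε, hεP, hε⟩ :=
    ((hcont.eventually (mem_interior_iff_mem_nhds.1 hxi)).and self_mem_nhdsWithin).exists
  have hε : 0 < ε := hε
  refine hvF (hF.2 hv hεP hx ⟨ε / (1 + ε), 1 / (1 + ε), by positivity, by positivity,
    by field_simp; ring, ?_⟩)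
  match_scalars
  all_goals field_simp
  all_goals ring

theorem mem_interior_dilate_iff {n k : ℕ} (hk : 0 < k) {P : Set (Fin n → ℝ)} {x : Fin n → ℝ} :
    x ∈ interior (dilate n k P) ↔ InteriorDilate P k x := by
  have hk' : (0 : ℝ) < k := by exact_mod_cast hk
  have : dilate n k P = (k : ℝ) • P := rfl
  rw [this, interior_smul₀ hk'.ne', mem_smul_set]
  simp [InteriorDilate, hk', eq_comm]

/-- A lattice 3-pyramid `P = Conv(F ∪ {v})` with `P ∩ ℤ³ = (F ∩ ℤ³) ∪ {v}` and exactly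
one lattice point in the interior of `2P` is Gorenstein. -/
theorem pyramid3_gorenstein (P F : Set (Fin 3 → ℝ)) (v : Fin 3 → ℝ)
    (hP : IsLatticePolytope 3 P)
    (hF : IsFacet 3 P F) (hv : v ∈ Set.extremePoints ℝ P) (hvF : v ∉ F)
    (hconv : P = convexHull ℝ (F ∪ {v}))
    (hlat : P ∩ lat 3 = (F ∩ lat 3) ∪ {v})
    (hint : ∃ m₀, interior (dilate 3 2 P) ∩ lat 3 = {m₀}) :
    Gorenstein 3 P := by
  obtain ⟨⟨S, -, hPS⟩, -⟩ := hP
  obtain ⟨m, hm⟩ := hint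
  set T : Set (Fin 3 → ℝ) := (fun m : Fin 3 → ℤ => fun i => (m i : ℝ)) '' (S : Set (Fin 3 → ℤ))
  have hTlat : T ⊆ lat 3 := by
    rintro _ ⟨a, -, rfl⟩ i
    exact ⟨a i, rfl⟩
  have hTfin : T.Finite := S.finite_toSet.image _
  have hPconv : Convex ℝ P := hPS ▸ convex_convexHull ℝ T
  have hiff : ∀ x, x ∈ interior (dilate 3 2 P) ↔ InteriorDilate P 2 x := fun x => by
    simpa using mem_interior_dilate_iff (x := x) (P := P) two_pos
  have hm' : m ∈ interior (dilate 3 2 P) ∩ lat 3 := hm ▸ mem_singleton m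
  have hm2 := (hiff m).1 hm'.1
  have h1 : ∀ x ∈ lat 3, x ∉ interior P := by
    intro x hx hxi
    rcases hlat.subset ⟨interior_subset hxi, hx⟩ with h | rfl
    · exact hF.1.notMem_interior hv.1 hvF h.1 hxi
    · obtain ⟨f, hf, hfv⟩ : ∃ f ∈ P, f ≠ x := by
        by_contra! hall
        have hsub : P ⊆ {x} := hall
        have := interior_mono hsub hxi
        simp at this
      exact (isExtreme_singleton.2 hv).notMem_interior hf hfv rfl hxi
  have h2 : ∀ x ∈ lat 3, InteriorDilate P 2 x → x = m := fun x hx h =>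
    hm.subset ⟨(hiff x).2 h, hx⟩
  intro w hw
  refine gorensteinAt_of_sub_mem hPconv hm'.2 hm2 (fun k hk y hy hyk => ?_) hw.1
    (hTlat (extremePoints_convexHull_subset (hPS ▸ hw)))
  rw [hPS] at hm2 h1 h2 hyk ⊢
  exact sub_mem_dilate_of_mem_interior_dilate hTfin hTlat hm'.2 hm2 h1 h2 hk hy hyk
end
end

section
/- Let P ⊆ ℝⁿ be a lattice n-simplex such that P ∩ ℤⁿ has exactly n+1 elements (namely the vertices). If the topological interior of the dilate (n−1)P contains no point of ℤⁿ, then P is basic: there exist A ∈ GL(n, ℤ) and b ∈ ℤⁿ such that the affine map x ↦ A·x + b carries P onto Conv{0, e₁, …, eₙ}, the convex hull of the origin and the standard basis vectors. -/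
open Set Pointwise

noncomputable section

/-- If a lattice simplex has no lattice points besides its vertices and the interior of its
`(n-1)`-st dilate has no lattice points, then every lattice point has integral barycentric
coordinates. -/
theorem exists_int_barycentric_coords {n : ℕ} (f : Fin (n + 1) → Fin n → ℤ)
    (b : AffineBasis (Fin (n + 1)) ℝ (Fin n → ℝ)) (hb : ∀ i j, b i j = (f i j : ℝ))
    (hlat : convexHull ℝ (Set.range b) ∩ lat n ⊆ Set.range b)
    (hempty : interior (dilate n (n - 1) (convexHull ℝ (Set.range b))) ∩ lat n = ∅)
    (x : Fin n → ℤ) :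
    ∃ c : Fin (n + 1) → ℤ, ∑ i, c i = 1 ∧ ∀ j, ∑ i, c i * f i j = x j := by
  set c : Fin (n + 1) → ℝ := fun i => b.coord i (fun j => (x j : ℝ)) with hc
  have hsum : ∑ i, c i = 1 := b.sum_coord_apply_eq_one _
  have hcomb : ∀ j, ∑ i, c i * (f i j : ℝ) = x j := fun j => by
    have h := congrFun (b.linear_combination_coord_eq_self (fun j => (x j : ℝ))) j
    simpa [hb, Finset.sum_apply] using h
  have coord_sum : ∀ (w : Fin (n + 1) → ℝ), ∑ i, w i = 1 →
      ∀ j, b.coord j (∑ i, w i • b i) = w j := fun w hw j => by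
    rw [← Finset.univ.affineCombination_eq_linear_combination b w hw,
      b.coord_apply_combination_of_mem (Finset.mem_univ j) hw]
  set h : ℤ := 1 - ∑ i, ⌊c i⌋ with hh
  have hfr : ∑ i, Int.fract (c i) = (h : ℝ) := by
    simp only [Int.fract, Finset.sum_sub_distrib, hsum, hh]
    push_cast
    rfl
  have h_nonneg : 0 ≤ h := by
    have : (0 : ℝ) ≤ h := hfr ▸ Finset.sum_nonneg fun i _ => Int.fract_nonneg _
    exact_mod_cast this
  have h_lt : h < n + 1 := by
    have : (h : ℝ) < n + 1 := by
      rw [← hfr]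
      calc ∑ i, Int.fract (c i) < ∑ _i : Fin (n + 1), (1 : ℝ) :=
            Finset.sum_lt_sum_of_nonempty Finset.univ_nonempty fun i _ => Int.fract_lt_one _
        _ = n + 1 := by simp
    exact_mod_cast this
  have h_cases : h = 0 ∨ h = 1 ∨ 2 ≤ h := by omega
  rcases h_cases with h0 | h1 | h2
  · have hz : ∀ i, Int.fract (c i) = 0 := by
      have := (Finset.sum_eq_zero_iff_of_nonneg
        (fun i _ => Int.fract_nonneg (c i))).1 (by rw [hfr, h0, Int.cast_zero])
      exact fun i => this i (Finset.mem_univ i)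
    have hfl : ∀ i, c i = (⌊c i⌋ : ℝ) := fun i => by
      have := Int.self_sub_floor (c i)
      linarith [hz i]
    refine ⟨fun i => ⌊c i⌋, by linarith, fun j => ?_⟩
    have := hcomb j
    rw [Finset.sum_congr rfl fun i _ => by rw [hfl i]] at this
    exact_mod_cast this
  · exfalso
    have hs : ∑ i, Int.fract (c i) = 1 := by rw [hfr, h1, Int.cast_one]
    have hmem : (∑ i, Int.fract (c i) • b i) ∈ convexHull ℝ (Set.range b) ∩ lat n := by
      constructor
      · rw [b.convexHull_eq_nonneg_coord]
        intro j
        rw [coord_sum _ hs]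
        exact Int.fract_nonneg _
      · intro j
        refine ⟨x j - ∑ i, ⌊c i⌋ * f i j, ?_⟩
        simp only [Finset.sum_apply, Pi.smul_apply, smul_eq_mul, hb, Int.fract, sub_mul,
          Finset.sum_sub_distrib, hcomb]
        push_cast
        rfl
    obtain ⟨j, hj⟩ := hlat hmem
    have h3 := coord_sum _ hs j
    rw [← hj, b.coord_apply_eq] at h3
    exact (Int.fract_lt_one (c j)).ne h3.symm
  · exfalso
    have hn : 2 ≤ n := by omega
    have hk : (0 : ℝ) < ((n - 1 : ℕ) : ℝ) := by exact_mod_cast (by omega : 0 < n - 1)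
    have hk' : ((n - 1 : ℕ) : ℝ) = n - 1 := by rw [Nat.cast_sub (by omega)]; simp
    set d : Fin (n + 1) → ℤ := fun i => if i = 0 then h - 2 else 0 with hd
    have hd0 : ∀ i, (0 : ℝ) ≤ d i := fun i => by
      have : 0 ≤ d i := by simp only [hd]; split_ifs <;> omega
      exact_mod_cast this
    have hds : ∑ i, (d i : ℝ) = h - 2 := by
      have : ∑ i, d i = h - 2 := by simp [hd]
      exact_mod_cast this
    set w : Fin (n + 1) → ℝ := fun i => (1 - Int.fract (c i) + d i) / ((n - 1 : ℕ) : ℝ) with hw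
    have hws : ∑ i, w i = 1 := by
      rw [← Finset.sum_div, div_eq_one_iff_eq hk.ne', Finset.sum_add_distrib,
        Finset.sum_sub_distrib, hfr, hds, hk']
      simp
      ring
    have hint : (∑ i, w i • b i) ∈ interior (convexHull ℝ (Set.range b)) := by
      rw [b.interior_convexHull]
      intro j
      rw [coord_sum _ hws]
      exact div_pos (by linarith [Int.fract_lt_one (c j), hd0 j]) hk
    have hmem : ((n - 1 : ℕ) : ℝ) • (∑ i, w i • b i) ∈
        interior (dilate n (n - 1) (convexHull ℝ (Set.range b))) ∩ lat n := by
      constructor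
      · have : dilate n (n - 1) (convexHull ℝ (Set.range b)) =
            ((n - 1 : ℕ) : ℝ) • convexHull ℝ (Set.range b) := rfl
        rw [this, interior_smul₀ hk.ne']
        exact Set.smul_mem_smul_set hint
      · intro j
        refine ⟨∑ i, (⌊c i⌋ + 1 + d i) * f i j - x j, ?_⟩
        push_cast
        rw [← hcomb j, ← Finset.sum_sub_distrib]
        simp only [Finset.sum_apply, Pi.smul_apply, smul_eq_mul, hb, Finset.mul_sum]
        refine Finset.sum_congr rfl fun i _ => ?_
        rw [← mul_assoc, hw, mul_div_cancel₀ _ hk.ne', Int.fract]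
        ring
    rw [hempty] at hmem
    exact hmem

/-- A lattice simplex for which every lattice point has integral barycentric coordinates is
basic. -/
theorem exists_unimodularMap_image_eq_basicSimplex {n : ℕ} (f : Fin (n + 1) → Fin n → ℤ)
    (hf : ∀ x : Fin n → ℤ, ∃ c : Fin (n + 1) → ℤ, ∑ i, c i = 1 ∧ ∀ j, ∑ i, c i * f i j = x j) :
    ∃ A : Matrix (Fin n) (Fin n) ℤ, ∃ b : Fin n → ℤ, IsUnit A.det ∧
      unimodularMap n A b ''
        convexHull ℝ (Set.range fun i => (fun j => (f i j : ℝ) : Fin n → ℝ)) =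
      basicSimplex n := by
  choose c hc1 hc2 using fun k : Fin n => hf (f 0 + Pi.single k 1)
  let M : Matrix (Fin n) (Fin n) ℤ := Matrix.of fun j i => f i.succ j - f 0 j
  let N : Matrix (Fin n) (Fin n) ℤ := Matrix.of fun i k => c k i.succ
  have hMN : M * N = 1 := by
    ext j k
    have h1 := hc1 k
    have h2 := hc2 k j
    rw [Fin.sum_univ_succ] at h1 h2
    simp only [Matrix.mul_apply, M, N, Matrix.of_apply, sub_mul, Finset.sum_sub_distrib,
      ← Finset.mul_sum, Matrix.one_apply]
    rw [Pi.add_apply, Pi.single_apply] at h2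
    have h3 : ∑ i : Fin n, c k i.succ = 1 - c k 0 := by omega
    rw [h3]
    simp only [mul_comm (f _ _)]
    linear_combination h2
  have hNM : N * M = 1 := mul_eq_one_comm.1 hMN
  have hmap : ∀ v : Fin n → ℤ, unimodularMap n N (-(N.mulVec (f 0))) (fun j => (v j : ℝ)) =
      fun i => ((N.mulVec (v - f 0) i : ℤ) : ℝ) := fun v => by
    ext i
    simp [unimodularMap, Matrix.mulVec, dotProduct, sub_eq_add_neg, mul_add,
      Finset.sum_add_distrib]
  refine ⟨N, -(N.mulVec (f 0)), ?_, ?_⟩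
  · exact IsUnit.of_mul_eq_one M.det (by rw [← Matrix.det_mul, hNM, Matrix.det_one])
  · let g : (Fin n → ℝ) →ᵃ[ℝ] (Fin n → ℝ) :=
      (N.map (Int.cast : ℤ → ℝ)).mulVecLin.toAffineMap +
        AffineMap.const ℝ _ (fun i => ((-(N.mulVec (f 0))) i : ℝ))
    have hg : unimodularMap n N (-(N.mulVec (f 0))) = g := by
      ext x i
      simp [unimodularMap, g]
    rw [hg, AffineMap.image_convexHull, basicSimplex, ← hg, ← Set.range_comp,
      Fin.range_fin_succ, Set.singleton_union]
    congr 2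
    · ext i
      simp [hmap]
    · congr 1
      ext k i
      simp only [Fin.tail, Function.comp_apply, hmap]
      rw [show N.mulVec (f k.succ - f 0) i = (N * M) i k from rfl, hNM, Matrix.one_apply,
        Pi.single_apply]
      push_cast
      rfl

/-- A lattice `n`-simplex `P` with exactly `n+1` lattice points, such that `(n-1)P` has
no interior lattice points, is basic. -/
theorem simplex_basic_of_no_interior (n : ℕ) (P : Set (Fin n → ℝ))
    (hP : IsLatticePolytope n P)
    (hsimp : ∃ f : Fin (n + 1) → (Fin n → ℤ),
      AffineIndependent ℝ (fun i => (fun j => (f i j : ℝ) : Fin n → ℝ)) ∧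
      P = convexHull ℝ (Set.range fun i => (fun j => (f i j : ℝ) : Fin n → ℝ)))
    (hcard : (P ∩ lat n).ncard = n + 1)
    (hempty : interior (dilate n (n - 1) P) ∩ lat n = ∅) :
    ∃ A : Matrix (Fin n) (Fin n) ℤ, ∃ b : Fin n → ℤ,
      IsUnit A.det ∧ unimodularMap n A b '' P = basicSimplex n := by
  obtain ⟨f, hf, rfl⟩ := hsimp
  let b : AffineBasis (Fin (n + 1)) ℝ (Fin n → ℝ) :=
    ⟨fun i j => (f i j : ℝ), hf, hf.affineSpan_eq_top_iff_card_eq_finrank_add_one.2 (by simp)⟩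
  have hsub : Set.range b ⊆ convexHull ℝ (Set.range b) ∩ lat n := by
    refine Set.subset_inter (subset_convexHull ℝ _) ?_
    rintro _ ⟨i, rfl⟩ j
    exact ⟨f i j, rfl⟩
  have hcard' : (convexHull ℝ (Set.range b) ∩ lat n).ncard = n + 1 := hcard
  have hrange : (Set.range b).ncard = n + 1 := by
    rw [← Set.image_univ, Set.ncard_image_of_injective _ b.ind.injective, Set.ncard_univ,
      Nat.card_fin]
  have heq : Set.range b = convexHull ℝ (Set.range b) ∩ lat n :=
    Set.eq_of_subset_of_ncard_le hsub (by rw [hcard', hrange])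
      (Set.finite_of_ncard_ne_zero (by rw [hcard']; exact n.succ_ne_zero))
  exact exists_unimodularMap_image_eq_basicSimplex f fun x =>
    exists_int_barycentric_coords f b (fun _ _ => rfl) heq.superset hempty x
end
end

section
/- For every n ≥ 3, the lattice n-simplex D_n := Conv{0, e₁, e₂, e₁+e₂+2e₃, e₄, …, eₙ} ⊆ ℝⁿ is Gorenstein, i.e. it is Gorenstein at every vertex. -/
open Set Pointwise

noncomputable section

/-- The cone of a simplex at a vertex is cut out by the barycentric functionals of the other
vertices. -/
lemma coneAt_simplex {ι : Type*} [Fintype ι] [DecidableEq ι] {n : ℕ} (v : ι → Fin n → ℝ)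
    (l : ι → (Fin n → ℝ) →ₗ[ℝ] ℝ) (hl : ∀ y, ∑ i, l i y • v i = y) (hsum : ∀ y, ∑ i, l i y = 0)
    (hv : ∀ i j k, i ≠ j → 0 ≤ l i (v k - v j)) (j : ι) :
    coneAt n (convexHull ℝ (range v)) (v j) = {y | ∀ i, i ≠ j → 0 ≤ l i y} := by
  ext y
  constructor
  · rintro ⟨r, hr, x, hx, rfl⟩ i hij
    have hsub : convexHull ℝ (range v) ⊆ {x | l i (v j) ≤ l i x} := by
      refine convexHull_min ?_ (convex_halfSpace_ge (l i).isLinear _)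
      rintro _ ⟨k, rfl⟩
      have := hv i j k hij
      rw [map_sub] at this
      exact sub_nonneg.mp this
    rw [map_smul, map_sub]
    exact mul_nonneg hr (sub_nonneg.mpr (hsub hx))
  · intro hy
    have hj : l j y ≤ 0 := by
      have h := hsum y
      rw [← Finset.add_sum_erase _ _ (Finset.mem_univ j)] at h
      have : 0 ≤ ∑ i ∈ Finset.univ.erase j, l i y :=
        Finset.sum_nonneg fun i hi => hy i (Finset.ne_of_mem_erase hi)
      linarith
    have hr : 0 < 1 - l j y := by linarith
    refine ⟨1 - l j y, hr.le, v j + (1 - l j y)⁻¹ • y, ?_, ?_⟩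
    · have hx : v j + (1 - l j y)⁻¹ • y =
          ∑ i, ((if i = j then 1 else 0) + (1 - l j y)⁻¹ * l i y) • v i := by
        simp only [add_smul, Finset.sum_add_distrib, mul_smul, ← Finset.smul_sum, hl, ite_smul,
          one_smul, zero_smul, Finset.sum_ite_eq', Finset.mem_univ, if_true]
      rw [hx]
      refine (convex_convexHull ℝ _).sum_mem (fun i _ => ?_) ?_
        fun i _ => subset_convexHull ℝ _ (mem_range_self i)
      · by_cases hij : i = j
        · subst hij
          have : 1 + (1 - l i y)⁻¹ * l i y = (1 - l i y)⁻¹ := by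
            field_simp
            ring
          rw [if_pos rfl, this]
          exact inv_nonneg.mpr hr.le
        · rw [if_neg hij, zero_add]
          exact mul_nonneg (inv_nonneg.mpr hr.le) (hy i hij)
      · rw [Finset.sum_add_distrib, ← Finset.mul_sum, hsum]
        simp
    · rw [add_sub_cancel_left, smul_inv_smul₀ hr.ne']

/-- The interior of a polyhedral cone on which some vector is strictly positive. -/
lemma interior_polyhedralCone {ι : Type*} [Finite ι] {n : ℕ} (l : ι → (Fin n → ℝ) →ₗ[ℝ] ℝ)
    (s : Set ι) (m : Fin n → ℝ) (hm : ∀ i ∈ s, 0 < l i m) :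
    interior {y | ∀ i ∈ s, 0 ≤ l i y} = {y | ∀ i ∈ s, 0 < l i y} := by
  apply subset_antisymm
  · intro y hy i hi
    have hc : Filter.Tendsto (fun t : ℝ => y - t • m) (nhdsWithin 0 (Ioi 0)) (nhds y) := by
      have : Continuous fun t : ℝ => y - t • m := by fun_prop
      simpa using (this.tendsto 0).mono_left nhdsWithin_le_nhds
    obtain ⟨t, ht, htpos⟩ :=
      ((hc.eventually (mem_interior_iff_mem_nhds.mp hy)).and self_mem_nhdsWithin).exists
    have h1 : 0 ≤ l i (y - t • m) := ht i hi
    rw [map_sub, map_smul, smul_eq_mul] at h1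
    have := mul_pos (mem_Ioi.mp htpos) (hm i hi)
    linarith
  · refine interior_maximal (fun y hy i hi => (hy i hi).le) ?_
    have : {y | ∀ i ∈ s, 0 < l i y} = ⋂ i ∈ s, {y | 0 < l i y} := by
      ext
      simp
    rw [this]
    exact s.toFinite.isOpen_biInter fun i _ =>
      isOpen_lt continuous_const (l i).continuous_of_finiteDimensional

/-- A polyhedral cone whose integral facet functionals all take the value `1` at a common lattice
point is Gorenstein. -/
lemma gorensteinAt_of_coneAt_eq {ι : Type*} [Finite ι] {n : ℕ} {P : Set (Fin n → ℝ)}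
    {w : Fin n → ℝ} (l : ι → (Fin n → ℝ) →ₗ[ℝ] ℝ) (s : Set ι)
    (hcone : coneAt n P w = {y | ∀ i ∈ s, 0 ≤ l i y})
    (hint : ∀ y ∈ lat n, ∀ i ∈ s, ∃ z : ℤ, l i y = z)
    (m : Fin n → ℝ) (hm : m ∈ lat n) (hm1 : ∀ i ∈ s, l i m = 1) : GorensteinAt n P w := by
  have hpos : ∀ i ∈ s, 0 < l i m := fun i hi => by simp [hm1 i hi]
  refine ⟨m, ⟨?_, hm⟩, ?_⟩
  · rw [hcone]
    exact fun i hi => (hpos i hi).le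
  rw [hcone, interior_polyhedralCone l s m hpos]
  ext y
  constructor
  · rintro ⟨hy, hyl⟩
    refine ⟨y - m, ⟨fun i hi => ?_, fun k => ?_⟩, add_sub_cancel m y⟩
    · obtain ⟨z, hz⟩ := hint y hyl i hi
      have h := hy i hi
      rw [hz] at h
      rw [map_sub, hm1 i hi, hz, sub_nonneg]
      exact_mod_cast Int.add_one_le_iff.mpr (Int.cast_pos.mp h)
    · obtain ⟨a, ha⟩ := hyl k
      obtain ⟨b, hb⟩ := hm k
      exact ⟨a - b, by simp [ha, hb]⟩
  · rintro ⟨x, ⟨hx, hxl⟩, rfl⟩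
    refine ⟨fun i hi => ?_, fun k => ?_⟩
    · have := hx i hi
      rw [map_add, hm1 i hi]
      linarith
    · obtain ⟨a, ha⟩ := hxl k
      obtain ⟨b, hb⟩ := hm k
      exact ⟨b + a, by simp [ha, hb]⟩

lemma two_mod_add_three (m : ℕ) : 2 % (m + 3) = 2 := Nat.mod_eq_of_lt (by omega)

lemma not_add_three_lt_three (k : ℕ) : ¬ k + 1 + 1 + 1 < 3 := by omega

/-- The vertices of `Dn (m + 3)`, with `none` indexing the origin. -/
def dnVertex (m : ℕ) : Option (Fin (m + 3)) → Fin (m + 3) → ℝ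
  | none => 0
  | some i => Pi.single i 1 + if i = 2 then Pi.single 0 1 + Pi.single 1 1 + Pi.single 2 1 else 0

/-- The linear parts of the barycentric coordinates of `Dn (m + 3)`. -/
def dnCoord (m : ℕ) : Option (Fin (m + 3)) → (Fin (m + 3) → ℝ) →ₗ[ℝ] ℝ
  | none => -∑ i : Fin (m + 3),
      (LinearMap.proj i - (if (i : ℕ) < 3 then (1 / 2 : ℝ) else 0) • LinearMap.proj 2)
  | some i => LinearMap.proj i - (if (i : ℕ) < 3 then (1 / 2 : ℝ) else 0) • LinearMap.proj 2

/-- The factors making the barycentric functionals of `Dn (m + 3)` primitive. -/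
def dnScale (m : ℕ) : Option (Fin (m + 3)) → ℝ
  | none => 2
  | some i => if (i : ℕ) < 3 then 2 else 1

lemma dnScale_pos (m : ℕ) (i : Option (Fin (m + 3))) : 0 < dnScale m i := by
  rcases i with _ | i
  · simp [dnScale]
  · simp only [dnScale]
    split_ifs <;> norm_num

lemma Dn_eq_convexHull_range (m : ℕ) : Dn (m + 3) = convexHull ℝ (range (dnVertex m)) := by
  have htop : (fun j : Fin (m + 3) => if (j : ℕ) = 0 ∨ (j : ℕ) = 1 then (1 : ℝ) else
      if (j : ℕ) = 2 then 2 else 0) = dnVertex m (some 2) := by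
    ext j
    refine Fin.cases ?_ (Fin.cases ?_ (Fin.cases ?_ fun k => ?_)) j
    all_goals simp [dnVertex, Fin.ext_iff, two_mod_add_three]
    all_goals norm_num
  have hval : ∀ i : Fin (m + 3), (i : ℕ) ≠ 2 ↔ i ≠ 2 := fun i => by
    simp [Fin.ext_iff, two_mod_add_three]
  rw [Dn, htop]
  congr 1
  ext x
  constructor
  · rintro ((rfl | ⟨i, hi, rfl⟩) | rfl)
    · exact ⟨none, rfl⟩
    · exact ⟨some i, by simp [dnVertex, (hval i).mp hi]⟩
    · exact ⟨some 2, rfl⟩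
  · rintro ⟨_ | i, rfl⟩
    · exact Or.inl (Or.inl rfl)
    · by_cases hi : i = 2
      · subst hi
        exact Or.inr rfl
      · exact Or.inl (Or.inr ⟨i, (hval i).mpr hi, by simp [dnVertex, hi]⟩)

lemma dnCoord_none (m : ℕ) (y : Fin (m + 3) → ℝ) :
    dnCoord m none y = -∑ i, dnCoord m (some i) y := by
  simp [dnCoord]

lemma dnCoord_some (m : ℕ) (i : Fin (m + 3)) (y : Fin (m + 3) → ℝ) :
    dnCoord m (some i) y = y i - (if (i : ℕ) < 3 then (1 / 2 : ℝ) else 0) * y 2 := by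
  rfl

lemma dnCoord_some_vertex (m : ℕ) (i k : Fin (m + 3)) :
    dnCoord m (some i) (dnVertex m (some k)) = if i = k then 1 else 0 := by
  rw [dnCoord_some]
  by_cases hk : k = 2
  · subst hk
    refine Fin.cases ?_ (Fin.cases ?_ (Fin.cases ?_ fun k => ?_)) i
    all_goals simp [dnVertex, Fin.ext_iff, two_mod_add_three, not_add_three_lt_three]
    all_goals norm_num
  · simp [dnVertex, hk, Pi.single_apply, Ne.symm hk]

lemma sum_dnCoord (m : ℕ) (y : Fin (m + 3) → ℝ) : ∑ i, dnCoord m i y = 0 := by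
  rw [Fintype.sum_option, dnCoord_none, neg_add_cancel]

lemma sum_dnCoord_smul_vertex (m : ℕ) (y : Fin (m + 3) → ℝ) :
    ∑ i, dnCoord m i y • dnVertex m i = y := by
  rw [Fintype.sum_option]
  simp only [dnVertex, smul_zero, zero_add, smul_add, smul_ite, Finset.sum_add_distrib,
    Finset.sum_ite_eq', Finset.mem_univ, if_true]
  ext k
  simp only [Pi.add_apply, Finset.sum_apply, Pi.smul_apply, Pi.single_apply, smul_eq_mul, mul_ite,
    mul_one, mul_zero, Finset.sum_ite_eq, Finset.mem_univ, if_true, dnCoord_some]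
  refine Fin.cases ?_ (Fin.cases ?_ (Fin.cases ?_ fun k => ?_)) k
  all_goals simp [Fin.ext_iff, two_mod_add_three, not_add_three_lt_three]
  all_goals ring_nf

lemma dnCoord_vertex_sub_nonneg (m : ℕ) (i j k : Option (Fin (m + 3))) (hij : i ≠ j) :
    0 ≤ dnCoord m i (dnVertex m k - dnVertex m j) := by
  have h0 : dnVertex m none = 0 := rfl
  rw [map_sub]
  rcases i with _ | i <;> rcases j with _ | j <;> rcases k with _ | k
  all_goals simp_all [dnCoord_none, dnCoord_some_vertex]
  all_goals split_ifs <;> norm_num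

lemma dnVertex_mem_lat (m : ℕ) (j : Option (Fin (m + 3))) : dnVertex m j ∈ lat (m + 3) := by
  intro k
  rcases j with _ | j
  · exact ⟨0, by simp [dnVertex]⟩
  · refine ⟨(Pi.single j 1 + if j = 2 then Pi.single 0 1 + Pi.single 1 1 + Pi.single 2 1 else 0 :
      Fin (m + 3) → ℤ) k, ?_⟩
    by_cases hj : j = 2 <;> simp [dnVertex, hj, Pi.single_apply]

lemma dnScale_mul_dnCoord_integral (m : ℕ) (y : Fin (m + 3) → ℝ) (hy : y ∈ lat (m + 3))
    (i : Option (Fin (m + 3))) : ∃ z : ℤ, dnScale m i * dnCoord m i y = z := by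
  choose z hz using hy
  rcases i with _ | i
  · refine ⟨-(2 * ∑ i, z i - 3 * z 2), ?_⟩
    have : ∑ i : Fin (m + 3), (if (i : ℕ) < 3 then (1 / 2 : ℝ) else 0) = 3 / 2 := by
      simp [Fin.sum_univ_succ, not_add_three_lt_three]
      norm_num
    simp only [dnScale, dnCoord_none, dnCoord_some, Finset.sum_sub_distrib, ← Finset.sum_mul, this,
      hz]
    push_cast
    ring
  · by_cases hi : (i : ℕ) < 3
    · exact ⟨2 * z i - z 2, by simp [dnScale, dnCoord_some, hi, hz]; ring⟩
    · exact ⟨z i, by simp [dnScale, dnCoord_some, hi, hz]⟩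

lemma dnScale_mul_dnCoord_eq_one (m : ℕ) (i j : Option (Fin (m + 3))) (hij : i ≠ j) :
    dnScale m i * dnCoord m i (1 - ((m : ℝ) + 2) • dnVertex m j) = 1 := by
  have h0 : dnVertex m none = 0 := rfl
  rw [map_sub, map_smul, smul_eq_mul]
  rcases i with _ | i
  · rcases j with _ | j
    · exact absurd rfl hij
    have : ∑ i : Fin (m + 3), (1 - if (i : ℕ) < 3 then (1 / 2 : ℝ) else 0) = m + 3 / 2 := by
      simp [Fin.sum_univ_succ, not_add_three_lt_three]
      ring
    simp only [dnCoord_none, dnCoord_some_vertex, Finset.sum_ite_eq', Finset.mem_univ, if_true]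
    simp only [dnCoord_some, Pi.one_apply, mul_one, this, dnScale]
    ring
  · have hj : dnCoord m (some i) (dnVertex m j) = 0 := by
      rcases j with _ | j
      · rw [h0, map_zero]
      · rw [dnCoord_some_vertex, if_neg fun h => hij (congrArg some h)]
    rw [hj, dnCoord_some]
    by_cases hi : (i : ℕ) < 3 <;> simp [dnScale, hi]
    norm_num

/-- For every `n ≥ 3`, the simplex `D_n` is Gorenstein. -/
theorem Dn_gorenstein (n : ℕ) (hn : 3 ≤ n) : Gorenstein n (Dn n) := by
  obtain ⟨m, rfl⟩ := Nat.exists_eq_add_of_le' hn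
  intro v hv
  rw [Dn_eq_convexHull_range] at hv ⊢
  obtain ⟨j, rfl⟩ := extremePoints_convexHull_subset hv
  refine gorensteinAt_of_coneAt_eq (fun i => dnScale m i • dnCoord m i) {i | i ≠ j} ?_
    (fun y hy i _ => dnScale_mul_dnCoord_integral m y hy i)
    (1 - ((m : ℝ) + 2) • dnVertex m j) ?_ fun i hi => dnScale_mul_dnCoord_eq_one m i j hi
  · rw [coneAt_simplex _ _ (sum_dnCoord_smul_vertex m) (sum_dnCoord m)
      (dnCoord_vertex_sub_nonneg m)]
    ext y
    simp [mul_nonneg_iff_of_pos_left (dnScale_pos m _)]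
  · intro k
    obtain ⟨z, hz⟩ := dnVertex_mem_lat m j k
    exact ⟨1 - (m + 2) * z, by simp [hz]⟩
end
end

section
/- For every n ≥ 3, the lattice n-simplex D_n := Conv{0, e₁, e₂, e₁+e₂+2e₃, e₄, …, eₙ} ⊆ ℝⁿ is not normal: there exists an integer k ≥ 1 such that (k·D_n) ∩ ℤⁿ + D_n ∩ ℤⁿ ≠ ((k+1)·D_n) ∩ ℤⁿ. In fact, the point e₁ + e₂ + e₃ lies in (2·D_n) ∩ ℤⁿ but is not a sum of two points of D_n ∩ ℤⁿ. -/
open Set Pointwise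

noncomputable section

/-- Linear inequalities on the first three coordinates that hold on `D_n`. -/
lemma Dn_inequalities {n : ℕ} (hn : 3 ≤ n) {x : Fin n → ℝ} (hx : x ∈ Dn n) :
    0 ≤ x ⟨2, by omega⟩ ∧ x ⟨2, by omega⟩ ≤ 2 * x ⟨0, by omega⟩ ∧
      x ⟨2, by omega⟩ ≤ 2 * x ⟨1, by omega⟩ ∧
      2 * x ⟨0, by omega⟩ + 2 * x ⟨1, by omega⟩ - x ⟨2, by omega⟩ ≤ 2 := by
  refine convexHull_min (t := {x : Fin n → ℝ | 0 ≤ x ⟨2, by omega⟩ ∧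
      x ⟨2, by omega⟩ ≤ 2 * x ⟨0, by omega⟩ ∧ x ⟨2, by omega⟩ ≤ 2 * x ⟨1, by omega⟩ ∧
      2 * x ⟨0, by omega⟩ + 2 * x ⟨1, by omega⟩ - x ⟨2, by omega⟩ ≤ 2}) ?_ ?_ hx
  · rintro x ((rfl | ⟨i, hi, rfl⟩) | rfl)
    · simp
    · simp only [mem_ofPred_eq, Pi.single_apply, Fin.ext_iff]
      split_ifs <;> first | omega | norm_num
    · norm_num
  · rintro x ⟨h1, h2, h3, h4⟩ y ⟨k1, k2, k3, k4⟩ a b ha hb hab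
    simp only [mem_ofPred_eq, Pi.add_apply, Pi.smul_apply, smul_eq_mul]
    refine ⟨by positivity, ?_, ?_, ?_⟩
    · nlinarith [mul_le_mul_of_nonneg_left h2 ha, mul_le_mul_of_nonneg_left k2 hb]
    · nlinarith [mul_le_mul_of_nonneg_left h3 ha, mul_le_mul_of_nonneg_left k3 hb]
    · nlinarith [mul_le_mul_of_nonneg_left h4 ha, mul_le_mul_of_nonneg_left k4 hb]

/-- No lattice point of `D_n` has third coordinate `1`. -/
lemma third_coord_ne_one {n : ℕ} (hn : 3 ≤ n) {x : Fin n → ℝ} (hx : x ∈ Dn n ∩ lat n) :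
    x ⟨2, by omega⟩ ≠ 1 := by
  intro h
  obtain ⟨-, h0, h1, h2⟩ := Dn_inequalities hn hx.1
  obtain ⟨a, ha⟩ := hx.2 ⟨0, by omega⟩
  obtain ⟨b, hb⟩ := hx.2 ⟨1, by omega⟩
  rw [h, ha] at h0
  rw [h, hb] at h1
  rw [h, ha, hb] at h2
  norm_cast at h0 h1
  have h2' : 2 * a + 2 * b - 1 ≤ 2 := by exact_mod_cast h2
  omega

/-- The point `e₁ + e₂ + e₃` lies in `2 D_n`. -/
lemma sum_three_mem_dilate_two {n : ℕ} (hn : 3 ≤ n) :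
    (fun j : Fin n => if (j : ℕ) ≤ 2 then (1 : ℝ) else 0) ∈ dilate n 2 (Dn n) := by
  let e : Fin 4 → Fin n → ℝ := ![0, Pi.single ⟨0, by omega⟩ 1, Pi.single ⟨1, by omega⟩ 1,
    fun j => if (j : ℕ) = 0 ∨ (j : ℕ) = 1 then (1 : ℝ) else if (j : ℕ) = 2 then 2 else 0]
  have he : ∀ i, e i ∈ Dn n := by
    intro i
    apply subset_convexHull
    fin_cases i
    · exact Or.inl (Or.inl rfl)
    · exact Or.inl (Or.inr ⟨⟨0, by omega⟩, by simp, rfl⟩)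
    · exact Or.inl (Or.inr ⟨⟨1, by omega⟩, by simp, rfl⟩)
    · exact Or.inr rfl
  refine ⟨∑ i, (1 / 4 : ℝ) • e i, (convex_convexHull ℝ _).sum_mem (fun _ _ => by norm_num)
    (by norm_num) (fun i _ => he i), ?_⟩
  ext j
  simp only [e, Fin.sum_univ_four, Matrix.cons_val, Pi.smul_apply, Pi.add_apply, Pi.single_apply,
    Fin.ext_iff, smul_eq_mul, Pi.zero_apply]
  split_ifs <;> first | omega | norm_num

/-- For every `n ≥ 3`, the simplex `D_n` is not normal: the point `e₁ + e₂ + e₃` lies in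
`(2·D_n) ∩ ℤⁿ` but is not a sum of two lattice points of `D_n`. -/
theorem Dn_not_normal (n : ℕ) (hn : 3 ≤ n) :
    ((fun j : Fin n => if (j : ℕ) ≤ 2 then (1 : ℝ) else 0) ∈ dilate n 2 (Dn n) ∩ lat n ∧
      (fun j : Fin n => if (j : ℕ) ≤ 2 then (1 : ℝ) else 0) ∉
        (Dn n ∩ lat n) + (Dn n ∩ lat n)) ∧
    ∃ k : ℕ, 1 ≤ k ∧
      (dilate n k (Dn n) ∩ lat n) + (Dn n ∩ lat n) ≠ dilate n (k + 1) (Dn n) ∩ lat n := by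
  have hmem : (fun j : Fin n => if (j : ℕ) ≤ 2 then (1 : ℝ) else 0) ∈
      dilate n 2 (Dn n) ∩ lat n := by
    refine ⟨sum_three_mem_dilate_two hn, fun i => ⟨if (i : ℕ) ≤ 2 then 1 else 0, ?_⟩⟩
    push_cast
    rfl
  have hnot : (fun j : Fin n => if (j : ℕ) ≤ 2 then (1 : ℝ) else 0) ∉
      (Dn n ∩ lat n) + (Dn n ∩ lat n) := by
    rintro ⟨x, hx, y, hy, hxy⟩
    have hsum : x ⟨2, by omega⟩ + y ⟨2, by omega⟩ = 1 := by
      simpa using congrFun hxy ⟨2, by omega⟩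
    have hx0 := (Dn_inequalities hn hx.1).1
    have hy0 := (Dn_inequalities hn hy.1).1
    have hx1 := third_coord_ne_one hn hx
    have hy1 := third_coord_ne_one hn hy
    obtain ⟨a, ha⟩ := hx.2 ⟨2, by omega⟩
    obtain ⟨b, hb⟩ := hy.2 ⟨2, by omega⟩
    rw [ha] at hsum hx0 hx1
    rw [hb] at hsum hy0 hy1
    norm_cast at hsum hx0 hy0 hx1 hy1
    omega
  refine ⟨⟨hmem, hnot⟩, 1, le_rfl, fun h => hnot ?_⟩
  have hone : dilate n 1 (Dn n) = Dn n := by simp [dilate]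
  rw [hone] at h
  rw [h]
  exact hmem
end
end

section
/- Let D := Conv{(0,0,0), (1,0,0), (0,1,0), (2,2,5)} ⊆ ℝ³. Then the point (1,1,2) lies in the topological interior of D, and D is not Gorenstein at its vertex 0 = (0,0,0); in particular, the analogue of the two-dimensional statement 'one interior lattice point implies Gorenstein' fails in dimension three. -/
open Set Pointwise

noncomputable section

lemma mem_tetrahedron_iff (x : Fin 3 → ℝ) :
    x ∈ convexHull ℝ {![(0 : ℝ), 0, 0], ![1, 0, 0], ![0, 1, 0], ![2, 2, 5]} ↔
      0 ≤ x 2 ∧ 2 * x 2 ≤ 5 * x 0 ∧ 2 * x 2 ≤ 5 * x 1 ∧ 5 * x 0 + 5 * x 1 - 3 * x 2 ≤ 5 := by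
  constructor
  · intro hx
    refine convexHull_min (t := {x : Fin 3 → ℝ | 0 ≤ x 2 ∧ 2 * x 2 ≤ 5 * x 0 ∧
      2 * x 2 ≤ 5 * x 1 ∧ 5 * x 0 + 5 * x 1 - 3 * x 2 ≤ 5}) ?_ ?_ hx
    · rintro y (rfl | rfl | rfl | rfl) <;> (simp; try norm_num)
    · rintro y ⟨h1, h2, h3, h4⟩ z ⟨k1, k2, k3, k4⟩ a b ha hb hab
      simp only [mem_ofPred_eq, Pi.add_apply, Pi.smul_apply, smul_eq_mul]
      refine ⟨by positivity, ?_, ?_, ?_⟩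
      · nlinarith
      · nlinarith
      · nlinarith
  · rintro ⟨h1, h2, h3, h4⟩
    have hs := subset_convexHull ℝ
      ({![(0 : ℝ), 0, 0], ![1, 0, 0], ![0, 1, 0], ![2, 2, 5]} : Set (Fin 3 → ℝ))
    have hc := (convex_convexHull ℝ
      ({![(0 : ℝ), 0, 0], ![1, 0, 0], ![0, 1, 0], ![2, 2, 5]} : Set (Fin 3 → ℝ))).sum_mem
      (t := Finset.univ)
      (w := ![1 - (x 0 + x 1 - 3 * x 2 / 5), x 0 - 2 * x 2 / 5, x 1 - 2 * x 2 / 5, x 2 / 5])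
      (z := ![![0, 0, 0], ![1, 0, 0], ![0, 1, 0], ![2, 2, 5]])
      (by intro i _; fin_cases i <;> simp <;> linarith)
      (by simp [Fin.sum_univ_four]; ring)
      (by intro i _; apply hs; fin_cases i <;> simp)
    convert hc using 1
    ext i
    fin_cases i <;> simp [Fin.sum_univ_four] <;> ring

lemma mem_coneAt_tetrahedron_iff (x : Fin 3 → ℝ) :
    x ∈ coneAt 3 (convexHull ℝ {![(0 : ℝ), 0, 0], ![1, 0, 0], ![0, 1, 0], ![2, 2, 5]})
      ![(0 : ℝ), 0, 0] ↔ 0 ≤ x 2 ∧ 2 * x 2 ≤ 5 * x 0 ∧ 2 * x 2 ≤ 5 * x 1 := by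
  have h0 : ![(0 : ℝ), 0, 0] = 0 := by ext i; fin_cases i <;> rfl
  constructor
  · rintro ⟨r, hr, y, hy, rfl⟩
    obtain ⟨h1, h2, h3, -⟩ := (mem_tetrahedron_iff y).1 hy
    simp only [h0, sub_zero, Pi.smul_apply, smul_eq_mul]
    exact ⟨by positivity, by nlinarith, by nlinarith⟩
  · rintro ⟨h1, h2, h3⟩
    have hr : 0 < x 0 + x 1 + 1 := by linarith
    refine ⟨x 0 + x 1 + 1, hr.le, (x 0 + x 1 + 1)⁻¹ • x, (mem_tetrahedron_iff _).2 ?_, ?_⟩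
    · have hi := inv_pos.2 hr
      have hm := inv_mul_cancel₀ hr.ne'
      simp only [Pi.smul_apply, smul_eq_mul]
      refine ⟨by positivity, ?_, ?_, ?_⟩ <;> nlinarith [mul_nonneg hi.le h1]
    · rw [h0, sub_zero, smul_inv_smul₀ hr.ne']

lemma mem_interior_coneAt_tetrahedron {x : Fin 3 → ℝ} (h1 : 0 < x 2)
    (h2 : 2 * x 2 < 5 * x 0) (h3 : 2 * x 2 < 5 * x 1) :
    x ∈ interior (coneAt 3
      (convexHull ℝ {![(0 : ℝ), 0, 0], ![1, 0, 0], ![0, 1, 0], ![2, 2, 5]})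
      ![(0 : ℝ), 0, 0]) := by
  refine mem_interior.2 ⟨{y | 0 < y 2 ∧ 2 * y 2 < 5 * y 0 ∧ 2 * y 2 < 5 * y 1},
    fun y hy => (mem_coneAt_tetrahedron_iff y).2 ⟨hy.1.le, hy.2.1.le, hy.2.2.le⟩, ?_,
    h1, h2, h3⟩
  refine IsOpen.and ?_ (IsOpen.and ?_ ?_) <;> exact isOpen_lt (by fun_prop) (by fun_prop)

lemma pos_of_mem_interior_coneAt_tetrahedron {x : Fin 3 → ℝ}
    (hx : x ∈ interior (coneAt 3
      (convexHull ℝ {![(0 : ℝ), 0, 0], ![1, 0, 0], ![0, 1, 0], ![2, 2, 5]})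
      ![(0 : ℝ), 0, 0])) : 0 < x 2 := by
  have hsub : coneAt 3 (convexHull ℝ {![(0 : ℝ), 0, 0], ![1, 0, 0], ![0, 1, 0], ![2, 2, 5]})
      ![(0 : ℝ), 0, 0] ⊆ (fun y : Fin 3 → ℝ => y 2) ⁻¹' Ici 0 :=
    fun y hy => ((mem_coneAt_tetrahedron_iff y).1 hy).1
  have h := interior_mono hsub hx
  rw [← (isOpenMap_eval (2 : Fin 3)).preimage_interior_eq_interior_preimage
    (continuous_apply 2), interior_Ici] at h
  exact h

/-- The tetrahedron `D = Conv{0, (1,0,0), (0,1,0), (2,2,5)}` contains `(1,1,2)` in its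
interior but is not Gorenstein at the vertex `0`. -/
theorem tetrahedron_counterexample :
    (![(1 : ℝ), 1, 2]) ∈ interior
      (convexHull ℝ {![(0 : ℝ), 0, 0], ![1, 0, 0], ![0, 1, 0], ![2, 2, 5]}) ∧
    ¬ GorensteinAt 3
      (convexHull ℝ {![(0 : ℝ), 0, 0], ![1, 0, 0], ![0, 1, 0], ![2, 2, 5]})
      (![(0 : ℝ), 0, 0]) := by
  refine ⟨?_, ?_⟩
  · refine mem_interior.2 ⟨{y | 0 < y 2 ∧ 2 * y 2 < 5 * y 0 ∧ 2 * y 2 < 5 * y 1 ∧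
      5 * y 0 + 5 * y 1 - 3 * y 2 < 5},
      fun y hy => (mem_tetrahedron_iff y).2 ⟨hy.1.le, hy.2.1.le, hy.2.2.1.le, hy.2.2.2.le⟩,
      ?_, by simp; norm_num⟩
    refine IsOpen.and ?_ (IsOpen.and ?_ (IsOpen.and ?_ ?_)) <;>
      exact isOpen_lt (by fun_prop) (by fun_prop)
  · rintro ⟨m, ⟨hm, hlat⟩, heq⟩
    have hmem : m ∈ (fun y => m + y) '' (coneAt 3 (convexHull ℝ
        {![(0 : ℝ), 0, 0], ![1, 0, 0], ![0, 1, 0], ![2, 2, 5]}) ![(0 : ℝ), 0, 0] ∩ lat 3) :=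
      ⟨0, ⟨(mem_coneAt_tetrahedron_iff 0).2 (by simp), fun i => ⟨0, by simp⟩⟩, add_zero m⟩
    rw [← heq] at hmem
    have hpos := pos_of_mem_interior_coneAt_tetrahedron hmem.1
    have h111 : ![(1 : ℝ), 1, 1] ∈ interior (coneAt 3 (convexHull ℝ
        {![(0 : ℝ), 0, 0], ![1, 0, 0], ![0, 1, 0], ![2, 2, 5]}) ![(0 : ℝ), 0, 0]) ∩ lat 3 :=
      ⟨mem_interior_coneAt_tetrahedron (by simp) (by simp; norm_num) (by simp; norm_num),
        fun i => ⟨![1, 1, 1] i, by fin_cases i <;> simp⟩⟩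
    have h112 : ![(1 : ℝ), 1, 2] ∈ interior (coneAt 3 (convexHull ℝ
        {![(0 : ℝ), 0, 0], ![1, 0, 0], ![0, 1, 0], ![2, 2, 5]}) ![(0 : ℝ), 0, 0]) ∩ lat 3 :=
      ⟨mem_interior_coneAt_tetrahedron (by simp) (by simp; norm_num) (by simp; norm_num),
        fun i => ⟨![1, 1, 2] i, by fin_cases i <;> simp⟩⟩
    rw [heq] at h111 h112
    obtain ⟨y, ⟨hy, -⟩, hmy⟩ := h111
    obtain ⟨z, ⟨hz, -⟩, hmz⟩ := h112
    obtain ⟨y2, -, -⟩ := (mem_coneAt_tetrahedron_iff y).1 hy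
    obtain ⟨-, z0, -⟩ := (mem_coneAt_tetrahedron_iff z).1 hz
    obtain ⟨-, m0, -⟩ := (mem_coneAt_tetrahedron_iff m).1 hm
    have e1 : m 2 + y 2 = 1 := by simpa using congrFun hmy 2
    have e2 : m 2 + z 2 = 2 := by simpa using congrFun hmz 2
    have e3 : m 0 + z 0 = 1 := by simpa using congrFun hmz 0
    obtain ⟨a, ha⟩ := hlat 0
    have hapos : (0 : ℝ) < a := by linarith
    have ha1 : (1 : ℝ) ≤ a := by exact_mod_cast hapos
    linarith
end
end
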